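/- Let M ⊂ ℂⁿ be a smooth pseudoconvex real hypersurface, p ∈ M, and let L be a smooth CR vector field along M with L(p) ≠ 0. Then c_L(M,p) ≤ max{t_L(M,p), 2·t_L(M,p) − 6}. -/

import Mathlib

open Topology

/-- ℂⁿ as a Pi type. -/
abbrev Cn (n : ℕ) := Fin n → ℂ

/-- The Wirtinger derivative `∂f/∂z_j` of a (real-)smooth function `f : ℂⁿ → ℂ`. -/
noncomputable def wz {n : ℕ} (j : Fin n) (f : Cn n → ℂ) (x : Cn n) : ℂ :=
  (fderiv ℝ f x (Pi.single j 1) - Complex.I * fderiv ℝ f x (Pi.single j Complex.I)) / 2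

/-- The Wirtinger derivative `∂f/∂z̄_j` of a (real-)smooth function `f : ℂⁿ → ℂ`. -/
noncomputable def wzb {n : ℕ} (j : Fin n) (f : Cn n → ℂ) (x : Cn n) : ℂ :=
  (fderiv ℝ f x (Pi.single j 1) + Complex.I * fderiv ℝ f x (Pi.single j Complex.I)) / 2

/-- The complexification of a real-valued function on ℂⁿ. -/
def cx {n : ℕ} (ρ : Cn n → ℝ) : Cn n → ℂ := fun x => (ρ x : ℂ)

/-- A complex vector field of mixed type `(1,0) + (0,1)` on ℂⁿ:
`W = Σ_j hol_j ∂/∂z_j + Σ_j anti_j ∂/∂z̄_j`. -/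
structure CVF (n : ℕ) where
  hol : Fin n → Cn n → ℂ
  anti : Fin n → Cn n → ℂ

/-- Action of a mixed-type complex vector field on functions, as a derivation. -/
noncomputable def CVF.act {n : ℕ} (W : CVF n) (f : Cn n → ℂ) : Cn n → ℂ :=
  fun x => (∑ j, W.hol j x * wz j f x) + (∑ j, W.anti j x * wzb j f x)

/-- Lie bracket of two mixed-type complex vector fields (with smooth coefficients the
commutator `[V,W]` of the first–order operators is again first order with these
coefficients). -/
noncomputable def CVF.bracket {n : ℕ} (V W : CVF n) : CVF n where
  hol := fun j x => V.act (W.hol j) x - W.act (V.hol j) x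
  anti := fun j x => V.act (W.anti j) x - W.act (V.anti j) x

/-- The `(1,0)` vector field `L = Σ_j a_j ∂/∂z_j`. -/
def LVF {n : ℕ} (a : Fin n → Cn n → ℂ) : CVF n := ⟨a, fun _ _ => 0⟩

/-- The conjugate `(0,1)` vector field `L̄ = Σ_j ā_j ∂/∂z̄_j`. -/
def LbarVF {n : ℕ} (a : Fin n → Cn n → ℂ) : CVF n :=
  ⟨fun _ _ => 0, fun j x => starRingEnd ℂ (a j x)⟩

/-- `a` is a smooth CR vector field along `M = {ρ = 0}`: smooth coefficients annihilating
`ρ` in the `(1,0)` directions, i.e. `Σ_j a_j ∂ρ/∂z_j = 0` on `M`. -/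
def IsCRField {n : ℕ} (ρ : Cn n → ℝ) (M : Set (Cn n)) (a : Fin n → Cn n → ℂ) : Prop :=
  (∀ j, ContDiff ℝ (⊤ : ℕ∞) (a j)) ∧ ∀ x ∈ M, ∑ j, a j x * wz j (cx ρ) x = 0

/-- Membership in the module `𝓜₁(L)` generated over smooth functions by `L` and `L̄`. -/
def InM1 {n : ℕ} (a : Fin n → Cn n → ℂ) (W : CVF n) : Prop :=
  ∃ c₁ c₂ : Cn n → ℂ, ContDiff ℝ (⊤ : ℕ∞) c₁ ∧ ContDiff ℝ (⊤ : ℕ∞) c₂ ∧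
    (∀ j x, W.hol j x = c₁ x * a j x) ∧ (∀ j x, W.anti j x = c₂ x * starRingEnd ℂ (a j x))

/-- `ν_L(f)(p)`: the smallest `m` such that `Y_m(⋯(Y_1 f)⋯)(p) ≠ 0` for some
`Y₁, …, Y_m ∈ 𝓜₁(L)`; `⊤` if no such `m` exists. -/
noncomputable def nuL {n : ℕ} (a : Fin n → Cn n → ℂ) (f : Cn n → ℂ) (p : Cn n) : ℕ∞ :=
  sInf {m : ℕ∞ | ∃ Ws : List (CVF n), (Ws.length : ℕ∞) = m ∧ (∀ W ∈ Ws, InM1 a W) ∧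
    (Ws.foldl (fun g W => W.act g) f) p ≠ 0}

/-- The coefficient `∂²ρ/∂z_j ∂z̄_l` of the Levi form. -/
noncomputable def leviCoeff {n : ℕ} (ρ : Cn n → ℝ) (j l : Fin n) (x : Cn n) : ℂ :=
  wz j (wzb l (cx ρ)) x

/-- The Levi form `λ(X,Y) = Σ_{j,l} (∂²ρ/∂z_j∂z̄_l) ξ_j η̄_l` of the fields with
coefficients `ξ`, `η`, as a function on ℂⁿ. -/
noncomputable def levi {n : ℕ} (ρ : Cn n → ℝ) (ξ η : Fin n → Cn n → ℂ) (x : Cn n) : ℂ :=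
  ∑ j, ∑ l, leviCoeff ρ j l x * ξ j x * starRingEnd ℂ (η l x)

/-- `M = {ρ = 0}` is pseudoconvex: the Levi form is positive semi-definite on the
CR directions at every point of `M`. -/
def Pseudoconvex {n : ℕ} (ρ : Cn n → ℝ) (M : Set (Cn n)) : Prop :=
  ∀ x ∈ M, ∀ ξ : Fin n → ℂ, (∑ j, ξ j * wz j (cx ρ) x) = 0 →
    0 ≤ (∑ j, ∑ l, leviCoeff ρ j l x * ξ j * starRingEnd ℂ (ξ l)).re

/-- Iterated commutators of length `μ` of elements of `𝓜₁(L)`: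
`[Y_μ, [Y_{μ-1}, ⋯ [Y₂, Y₁]⋯]]` with each `Y_i ∈ 𝓜₁(L)`. -/
inductive IsCommOf {n : ℕ} (a : Fin n → Cn n → ℂ) : ℕ → CVF n → Prop
  | one (W : CVF n) : InM1 a W → IsCommOf a 1 W
  | succ {μ : ℕ} (V W : CVF n) : InM1 a V → IsCommOf a μ W → IsCommOf a (μ + 1) (V.bracket W)

/-- The pairing `⟨∂ρ, G⟩(p)` of a mixed-type field with the `(1,0)` form `∂ρ`. -/
noncomputable def pairDRho {n : ℕ} (ρ : Cn n → ℝ) (G : CVF n) (p : Cn n) : ℂ :=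
  ∑ j, G.hol j p * wz j (cx ρ) p

/-- The commutator type `t_L(M,p)`: the smallest `m` such that `⟨∂ρ, G⟩(p) ≠ 0` for some
iterated commutator `G` of length (at most) `m` of elements of `𝓜₁(L)`; `⊤` if none. -/
noncomputable def tType {n : ℕ} (ρ : Cn n → ℝ) (a : Fin n → Cn n → ℂ) (p : Cn n) : ℕ∞ :=
  sInf {m : ℕ∞ | ∃ μ : ℕ, (μ : ℕ∞) = m ∧ ∃ G : CVF n, IsCommOf a μ G ∧ pairDRho ρ G p ≠ 0}

/-- The Levi-form type `c_L(M,p) = 2 + ν_L(λ(L,L))(p)`. -/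
noncomputable def cType {n : ℕ} (ρ : Cn n → ℝ) (a : Fin n → Cn n → ℂ) (p : Cn n) : ℕ∞ :=
  2 + nuL a (levi ρ a a) p

section LocalFlow

open Set Metric Filter

variable {E F : Type*} [NormedAddCommGroup E] [NormedSpace ℝ E]
  [NormedAddCommGroup F] [NormedSpace ℝ F]

/-- The derivative of `f` along the vector field `v`. -/
noncomputable def dirDeriv (v : E → E) (f : E → F) : E → F := fun x => fderiv ℝ f x (v x)

theorem contDiff_dirDeriv {v : E → E} {f : E → F} (hv : ContDiff ℝ (⊤ : ℕ∞) v)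
    (hf : ContDiff ℝ (⊤ : ℕ∞) f) : ContDiff ℝ (⊤ : ℕ∞) (dirDeriv v f) :=
  (hf.fderiv_right (m := (⊤ : ℕ∞)) (by simp)).clm_apply hv

theorem contDiff_dirDeriv_iterate {v : E → E} {f : E → F} (hv : ContDiff ℝ (⊤ : ℕ∞) v)
    (hf : ContDiff ℝ (⊤ : ℕ∞) f) (i : ℕ) : ContDiff ℝ (⊤ : ℕ∞) ((dirDeriv v)^[i] f) := by
  induction i generalizing f with
  | zero => exact hf
  | succ i ih => exact ih (contDiff_dirDeriv hv hf)

/-- `φ` is a local flow of `v` near `p`, defined for times in `[0, δ]`, with values in a fixed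
ball. -/
structure IsLocalFlow (v : E → E) (p : E) (δ R : ℝ) (φ : ℝ → E → E) : Prop where
  pos : 0 < δ
  initial : ∀ x ∈ closedBall p δ, φ 0 x = x
  hasDeriv : ∀ x ∈ closedBall p δ, ∀ s ∈ Icc 0 δ,
    HasDerivWithinAt (fun s => φ s x) (v (φ s x)) (Icc 0 δ) s
  mem_ball : ∀ x ∈ closedBall p δ, ∀ s ∈ Icc 0 δ, φ s x ∈ closedBall p R

theorem exists_isLocalFlow [FiniteDimensional ℝ E] {v : E → E} (hv : ContDiff ℝ (⊤ : ℕ∞) v) (p : E)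
    {R : ℝ} (hR : 0 < R) : ∃ δ φ, IsLocalFlow v p δ R φ := by
  have : CompleteSpace E := FiniteDimensional.complete ℝ E
  obtain ⟨ε, hε, a, r, L, K, hr, hpl⟩ := IsPicardLindelof.of_contDiffAt_one
    ((hv.of_le (by simp)).contDiffAt (x := p) : ContDiffAt ℝ 1 v p)
  obtain ⟨α, hα, hcont⟩ :=
    (hpl 0).exists_forall_mem_closedBall_eq_hasDerivWithinAt_continuousOn
  have hr' : (0 : ℝ) < r := hr
  have hp0 : (p, (0 : ℝ)) ∈ closedBall p (r : ℝ) ×ˢ Icc (0 - ε) (0 + ε) :=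
    ⟨mem_closedBall_self hr'.le, by constructor <;> linarith⟩
  have hval : α (p, 0) = p := (hα p hp0.1).1
  have hnhds : closedBall p (r : ℝ) ×ˢ Icc (0 - ε) (0 + ε) ∈ 𝓝 (p, (0 : ℝ)) :=
    prod_mem_nhds (closedBall_mem_nhds p hr') (Icc_mem_nhds (by linarith) (by linarith))
  have hU : α ⁻¹' closedBall p R ∈ 𝓝 (p, (0 : ℝ)) := by
    apply (hcont.continuousAt hnhds).preimage_mem_nhds
    rw [hval]
    exact closedBall_mem_nhds p hR
  obtain ⟨δ, hδ, hsub⟩ := Metric.nhds_basis_closedBall.mem_iff.1 (Filter.inter_mem hnhds hU)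
  have key : ∀ x ∈ closedBall p δ, ∀ s ∈ Icc 0 δ, (x, s) ∈ closedBall (p, (0 : ℝ)) δ := by
    intro x hx s hs
    rw [← closedBall_prod_same]
    exact ⟨hx, by simpa [abs_of_nonneg hs.1] using hs.2⟩
  refine ⟨δ, fun s x => α (x, s), hδ, fun x hx => ?_, fun x hx s hs => ?_, fun x hx s hs => ?_⟩
  · exact (hα x (hsub (key x hx 0 ⟨le_rfl, hδ.le⟩)).1.1).1
  · have h := hsub (key x hx s hs)
    refine ((hα x h.1.1).2 s h.1.2).mono fun s' hs' => ?_
    exact (hsub (key x hx s' hs')).1.2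
  · exact (hsub (key x hx s hs)).2

namespace IsLocalFlow

variable {v : E → E} {p : E} {δ R : ℝ} {φ : ℝ → E → E}

theorem hasDeriv_comp (hφ : IsLocalFlow v p δ R φ) {f : E → F} (hf : ContDiff ℝ (⊤ : ℕ∞) f)
    {x : E} (hx : x ∈ closedBall p δ) {s : ℝ} (hs : s ∈ Icc 0 δ) :
    HasDerivWithinAt (fun s => f (φ s x)) (dirDeriv v f (φ s x)) (Icc 0 δ) s :=
  ((hf.differentiable (by simp)).differentiableAt.hasFDerivAt).comp_hasDerivWithinAt s
    (hφ.hasDeriv x hx s hs)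

theorem taylor [FiniteDimensional ℝ E] (hφ : IsLocalFlow v p δ R φ)
    (hv : ContDiff ℝ (⊤ : ℕ∞) v) (N : ℕ) {f : E → F} (hf : ContDiff ℝ (⊤ : ℕ∞) f) :
    ∃ C, 0 ≤ C ∧ ∀ x ∈ closedBall p δ, ∀ s ∈ Icc 0 δ,
      ‖f (φ s x) - ∑ i ∈ Finset.range N, (s ^ i / i.factorial) • (dirDeriv v)^[i] f x‖
        ≤ C * s ^ N := by
  have : ProperSpace E := FiniteDimensional.proper ℝ E
  induction N generalizing f with
  | zero =>
    obtain ⟨C, hC⟩ := (isCompact_closedBall p R).exists_bound_of_continuousOn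
      hf.continuous.continuousOn
    refine ⟨max C 0, le_max_right _ _, fun x hx s hs => ?_⟩
    simpa using Or.inl (hC _ (hφ.mem_ball x hx s hs))
  | succ N ih =>
    obtain ⟨C, hC0, hC⟩ := ih (contDiff_dirDeriv hv hf)
    refine ⟨C, hC0, fun x hx s hs => ?_⟩
    set u : ℝ → F := fun r => f (φ r x) -
      ∑ i ∈ Finset.range (N + 1), (r ^ i / i.factorial) • (dirDeriv v)^[i] f x with hu
    have hu0 : u 0 = 0 := by
      simp [hu, Finset.sum_range_succ', hφ.initial x hx]
    have hderiv : ∀ r ∈ Icc 0 δ, HasDerivWithinAt u (dirDeriv v f (φ r x) -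
        ∑ i ∈ Finset.range N, (r ^ i / i.factorial) • (dirDeriv v)^[i] (dirDeriv v f) x)
        (Icc 0 δ) r := by
      intro r hr
      refine (hφ.hasDeriv_comp hf hx hr).sub ?_
      simp only [Finset.sum_range_succ']
      have : ∀ i ∈ Finset.range N, HasDerivWithinAt
          (fun r : ℝ => (r ^ (i + 1) / (i + 1).factorial) • (dirDeriv v)^[i + 1] f x)
          ((r ^ i / i.factorial) • (dirDeriv v)^[i] (dirDeriv v f) x) (Icc 0 δ) r := by
        intro i _
        rw [Function.iterate_succ_apply]
        refine HasDerivWithinAt.smul_const ?_ _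
        have h := ((hasDerivAt_pow (i + 1) r).div_const ((i + 1).factorial : ℝ)).hasDerivWithinAt
          (s := Icc 0 δ)
        refine h.congr_deriv ?_
        have : (i.factorial : ℝ) ≠ 0 := by positivity
        rw [Nat.factorial_succ]
        push_cast
        field_simp
      simpa using (HasDerivWithinAt.fun_sum this).add_const
        ((r ^ 0 / (Nat.factorial 0 : ℝ)) • f x)
    have hsub : Icc 0 s ⊆ Icc 0 δ := Icc_subset_Icc_right hs.2
    have := (convex_Icc (0 : ℝ) s).norm_image_sub_le_of_norm_hasDerivWithin_le
      (C := C * s ^ N) (fun r hr => (hderiv r (hsub hr)).mono hsub)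
      (fun r hr => (hC x hx r (hsub hr)).trans
        (mul_le_mul_of_nonneg_left (pow_le_pow_left₀ hr.1 hr.2 N) hC0))
      (left_mem_Icc.2 hs.1) (right_mem_Icc.2 hs.1)
    rw [hu0, sub_zero, sub_zero, Real.norm_of_nonneg hs.1] at this
    rw [pow_succ, ← mul_assoc]
    exact this

theorem norm_sub_le [FiniteDimensional ℝ E] (hφ : IsLocalFlow v p δ R φ)
    (hv : ContDiff ℝ (⊤ : ℕ∞) v) :
    ∃ C, 0 ≤ C ∧ ∀ x ∈ closedBall p δ, ∀ s ∈ Icc 0 δ, ‖φ s x - x‖ ≤ C * s := by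
  simpa using hφ.taylor hv 1 (f := id) contDiff_id

theorem eq_zero_of_le (hφ : IsLocalFlow v p δ R φ) {ρ : E → ℝ} (hρ : ContDiff ℝ (⊤ : ℕ∞) ρ)
    {C : ℝ} (hC : ∀ x ∈ closedBall p R, ‖dirDeriv v ρ x‖ ≤ C * ‖ρ x‖) {x : E}
    (hx : x ∈ closedBall p δ) (hx0 : ρ x = 0) {s : ℝ} (hs : s ∈ Icc 0 δ) : ρ (φ s x) = 0 := by
  refine eq_zero_of_abs_deriv_le_mul_abs_self_of_eq_zero_right (f := fun s => ρ (φ s x))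
    (f' := fun s => dirDeriv v ρ (φ s x)) (K := C) (a := 0) (b := δ)
    (fun r hr => (hφ.hasDeriv_comp hρ hx hr).continuousWithinAt) (fun r hr => ?_)
    (by simpa [hφ.initial x hx] using hx0)
    (fun r hr => hC _ (hφ.mem_ball x hx r (Ico_subset_Icc_self hr))) s hs
  have h := hφ.hasDeriv_comp hρ hx (Ico_subset_Icc_self hr)
  exact h.mono_of_mem_nhdsWithin
    (mem_of_superset (Icc_mem_nhdsGE hr.2) (Icc_subset_Icc_left hr.1))

end IsLocalFlow

/-- A smooth function vanishing on the regular level set `{ρ = 0}` is locally bounded by a multiple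
of `ρ`. -/
theorem exists_norm_le_mul_of_eq_zero [FiniteDimensional ℝ E] {ρ : E → ℝ}
    (hρ : ContDiff ℝ (⊤ : ℕ∞) ρ) {p : E} (hp : ρ p = 0) (hdp : fderiv ℝ ρ p ≠ 0)
    {f : E → F} (hf : ContDiff ℝ (⊤ : ℕ∞) f) (hf0 : ∀ x, ρ x = 0 → f x = 0) :
    ∃ R C, 0 < R ∧ ∀ x ∈ closedBall p R, ‖f x‖ ≤ C * ‖ρ x‖ := by
  have : CompleteSpace E := FiniteDimensional.complete ℝ E
  have hstrict : HasStrictFDerivAt ρ (fderiv ℝ ρ p) p :=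
    hρ.contDiffAt.hasStrictFDerivAt (by simp)
  have hsurj : (fderiv ℝ ρ p).range = ⊤ := by
    apply LinearMap.range_eq_top.2
    apply LinearMap.surjective
    intro h
    exact hdp (ContinuousLinearMap.coe_injective h)
  let f'symm := (fderiv ℝ ρ p).nonlinearRightInverseOfSurjective hsurj
  have f'symm_pos : 0 < f'symm.nnnorm :=
    (fderiv ℝ ρ p).nonlinearRightInverseOfSurjective_nnnorm_pos hsurj
  obtain ⟨s, hs, happrox⟩ := hstrict.approximates_deriv_on_nhds (c := f'symm.nnnorm⁻¹ / 2)
    (Or.inr (by positivity))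
  obtain ⟨K, t, ht, hlip⟩ := ((hf.of_le (by simp)).contDiffAt :
    ContDiffAt ℝ 1 f p).exists_lipschitzOnWith
  obtain ⟨r, hr, hrs⟩ := Metric.nhds_basis_closedBall.mem_iff.1 (Filter.inter_mem hs ht)
  set κ : ℝ := (f'symm.nnnorm : ℝ)⁻¹ / 2 with hκ
  have hκ0 : 0 < κ := by positivity
  have hsmall : {x | ‖ρ x‖ ≤ κ * (r / 2)} ∈ 𝓝 p := by
    refine (hρ.continuous.norm.tendsto p).eventually_le_const ?_
    simp only [hp, norm_zero]
    positivity
  obtain ⟨R, hR, hRs⟩ := Metric.nhds_basis_closedBall.mem_iff.1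
    (Filter.inter_mem hsmall (closedBall_mem_nhds p (half_pos hr)))
  refine ⟨R, K * κ⁻¹, hR, fun x hx => ?_⟩
  obtain ⟨hxs, hxr⟩ := hRs hx
  have hε : 0 ≤ κ⁻¹ * ‖ρ x‖ := by positivity
  have hεr : κ⁻¹ * ‖ρ x‖ ≤ r / 2 := by
    rw [inv_mul_le_iff₀ hκ0]
    exact hxs
  have hball : closedBall x (κ⁻¹ * ‖ρ x‖) ⊆ closedBall p r := by
    apply closedBall_subset_closedBall'
    have := mem_closedBall.1 hxr
    linarith
  have hsurjOn := happrox.surjOn_closedBall_of_nonlinearRightInverse f'symm hε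
    (hball.trans (hrs.trans inter_subset_left))
  have h0 : (0 : ℝ) ∈ closedBall (ρ x)
      (((f'symm.nnnorm : ℝ)⁻¹ - ((f'symm.nnnorm⁻¹ / 2 : NNReal) : ℝ)) * (κ⁻¹ * ‖ρ x‖)) := by
    have : ((f'symm.nnnorm : ℝ)⁻¹ - ((f'symm.nnnorm⁻¹ / 2 : NNReal) : ℝ)) = κ := by
      push_cast
      rw [hκ]
      ring
    rw [this, ← mul_assoc, mul_inv_cancel₀ hκ0.ne']
    simp
  obtain ⟨y, hy, hy0⟩ := hsurjOn h0
  have hxt : x ∈ t := (hrs (hball (mem_closedBall_self hε))).2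
  have hyt : y ∈ t := (hrs (hball hy)).2
  have := hlip.dist_le_mul x hxt y hyt
  rw [hf0 y hy0, dist_zero_right, dist_comm] at this
  calc ‖f x‖ ≤ K * dist y x := this
    _ ≤ K * (κ⁻¹ * ‖ρ x‖) := by
        gcongr
        exact hy
    _ = K * κ⁻¹ * ‖ρ x‖ := by ring

end LocalFlow

section VanishingOrder

open Set Metric Filter Asymptotics

variable {E ι : Type*}

/-- Points reached from `p` by following at most `k` of the flows `φ i` for time `s` each. -/
def flowReach (φ : ι → ℝ → E → E) (p : E) (s : ℝ) : ℕ → Set E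
  | 0 => {p}
  | k + 1 => flowReach φ p s k ∪ ⋃ i, φ i s '' flowReach φ p s k

/-- Iterated differences of `F` along the flows `φ i` at time `s`. -/
def flowDiff (φ : ι → ℝ → E → E) (s : ℝ) : List ι → (E → ℂ) → E → ℂ
  | [], F => F
  | i :: w, F => flowDiff φ s w fun y => F (φ i s y) - F y

section

variable {p : E} {φ : ι → ℝ → E → E}

theorem flowReach_succ_of_mem {s : ℝ} {k : ℕ} {z : E} (i : ι) (hz : z ∈ flowReach φ p s k) :
    φ i s z ∈ flowReach φ p s (k + 1) :=
  Or.inr (mem_iUnion.2 ⟨i, z, hz, rfl⟩)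

theorem flowReach_subset_succ {s : ℝ} {k : ℕ} : flowReach φ p s k ⊆ flowReach φ p s (k + 1) :=
  subset_union_left

theorem flowDiff_sum {α : Type*} (t : Finset α) (s : ℝ) (w : List ι) (c : α → ℂ)
    (F : α → E → ℂ) (x : E) :
    flowDiff φ s w (fun y => ∑ j ∈ t, c j * F j y) x = ∑ j ∈ t, c j * flowDiff φ s w (F j) x := by
  induction w generalizing F with
  | nil => rfl
  | cons i w ih =>
    simp only [flowDiff]
    rw [← ih]
    congr 1
    ext y
    rw [← Finset.sum_sub_distrib]
    exact Finset.sum_congr rfl fun j _ => by ring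

theorem flowDiff_add (s : ℝ) (w : List ι) (F G : E → ℂ) (x : E) :
    flowDiff φ s w (fun y => F y + G y) x = flowDiff φ s w F x + flowDiff φ s w G x := by
  induction w generalizing F G with
  | nil => rfl
  | cons i w ih =>
    simp only [flowDiff]
    rw [← ih]
    congr 1
    ext y
    ring

theorem norm_flowDiff_le {s B : ℝ} {w : List ι} {F : E → ℂ}
    (hF : ∀ y ∈ flowReach φ p s w.length, ‖F y‖ ≤ B) :
    ‖flowDiff φ s w F p‖ ≤ 2 ^ w.length * B := by
  induction w generalizing F B with
  | nil => simpa [flowDiff] using hF p rfl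
  | cons i w ih =>
    have := ih (F := fun y => F (φ i s y) - F y) (B := 2 * B) fun y hy => by
      have h1 := hF _ (flowReach_succ_of_mem i hy)
      have h2 := hF _ (flowReach_subset_succ hy)
      calc ‖F (φ i s y) - F y‖ ≤ ‖F (φ i s y)‖ + ‖F y‖ := _root_.norm_sub_le _ _
        _ ≤ 2 * B := by linarith
    calc ‖flowDiff φ s (i :: w) F p‖ ≤ 2 ^ w.length * (2 * B) := this
      _ = _ := by rw [List.length_cons, pow_succ]; ring

end

variable [NormedAddCommGroup E] [NormedSpace ℝ E]

/-- `VanishesToOrder v p m f`: all iterated derivatives of `f` of length `< m` along the vector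
fields `v i` vanish at `p`. -/
def VanishesToOrder (v : ι → E → E) (p : E) : ℕ → (E → ℂ) → Prop
  | 0, _ => True
  | m + 1, f => f p = 0 ∧ ∀ i, VanishesToOrder v p m (dirDeriv (v i) f)

variable {v : ι → E → E} {p : E} {δ R : ι → ℝ} {φ : ι → ℝ → E → E}

namespace VanishesToOrder

theorem mono {m l : ℕ} (h : l ≤ m) {f : E → ℂ} (hf : VanishesToOrder v p m f) :
    VanishesToOrder v p l f := by
  induction l generalizing m f with
  | zero => trivial
  | succ l ih =>
    obtain ⟨m, rfl⟩ : ∃ m', m = m' + 1 := ⟨m - 1, by omega⟩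
    exact ⟨hf.1, fun i => ih (by omega) (hf.2 i)⟩

theorem iterate {m : ℕ} {f : E → ℂ} (hf : VanishesToOrder v p m f) (i : ι) (j : ℕ) :
    VanishesToOrder v p (m - j) ((dirDeriv (v i))^[j] f) := by
  induction j generalizing m f with
  | zero => exact hf
  | succ j ih =>
    rcases m with _ | m
    · simp [VanishesToOrder]
    · have := ih (hf.2 i)
      rwa [← Nat.add_sub_add_right m 1 j] at this

theorem of_foldl {m : ℕ} {f : E → ℂ}
    (h : ∀ w : List ι, w.length < m → w.foldl (fun g i => dirDeriv (v i) g) f p = 0) :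
    VanishesToOrder v p m f := by
  induction m generalizing f with
  | zero => trivial
  | succ m ih =>
    exact ⟨h [] (by simp), fun i => ih fun w hw => h (i :: w) (by simpa using hw)⟩

end VanishesToOrder

section

variable [FiniteDimensional ℝ E] [Fintype ι]

theorem eventually_flowReach_dist_le (hφ : ∀ i, IsLocalFlow (v i) p (δ i) (R i) (φ i))
    (hv : ∀ i, ContDiff ℝ (⊤ : ℕ∞) (v i)) {M : Set E} (hp : p ∈ M)
    (hM : ∀ i, ∀ x ∈ closedBall p (δ i), x ∈ M → ∀ s ∈ Icc 0 (δ i), φ i s x ∈ M) (k : ℕ) :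
    ∃ C, 0 ≤ C ∧ ∀ᶠ s in 𝓝[>] (0 : ℝ), ∀ y ∈ flowReach φ p s k, dist y p ≤ C * s ∧ y ∈ M := by
  induction k with
  | zero => exact ⟨0, le_rfl, Eventually.of_forall fun s y hy => by
      rw [mem_singleton_iff.1 hy]; simpa using hp⟩
  | succ k ih =>
    obtain ⟨C, hC0, hC⟩ := ih
    choose C' hC'0 hC' using fun i => (hφ i).norm_sub_le (hv i)
    have hsum : ∀ i, C' i ≤ ∑ i, C' i := fun i =>
      Finset.single_le_sum (fun j _ => hC'0 j) (Finset.mem_univ i)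
    have hsum0 : 0 ≤ ∑ i, C' i := Finset.sum_nonneg fun i _ => hC'0 i
    refine ⟨C + ∑ i, C' i, by positivity, ?_⟩
    have hsmall : ∀ᶠ s in 𝓝[>] (0 : ℝ), ∀ i, C * s ≤ δ i ∧ s ≤ δ i := by
      refine eventually_all.2 fun i => ?_
      have h1 : Tendsto (fun s : ℝ => C * s) (𝓝[>] 0) (𝓝 0) := by
        have : Tendsto (fun s : ℝ => C * s) (𝓝 0) (𝓝 (C * 0)) :=
          (continuous_const.mul continuous_id).tendsto 0
        rw [mul_zero] at this
        exact this.mono_left nhdsWithin_le_nhds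
      have h2 : Tendsto (fun s : ℝ => s) (𝓝[>] 0) (𝓝 0) := tendsto_id.mono_left nhdsWithin_le_nhds
      exact (h1.eventually_le_const (hφ i).pos).and (h2.eventually_le_const (hφ i).pos)
    filter_upwards [hC, hsmall, self_mem_nhdsWithin] with s hs hsδ hs0 y hy
    have hs0' : 0 ≤ s := le_of_lt hs0
    rcases hy with hy | hy
    · refine ⟨(hs y hy).1.trans ?_, (hs y hy).2⟩
      nlinarith
    · obtain ⟨i, z, hz, rfl⟩ := mem_iUnion.1 hy
      obtain ⟨hzp, hzM⟩ := hs z hz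
      have hzδ : z ∈ closedBall p (δ i) := hzp.trans (hsδ i).1
      refine ⟨?_, hM i z hzδ hzM s ⟨hs0', (hsδ i).2⟩⟩
      have h1 := hC' i z hzδ s ⟨hs0', (hsδ i).2⟩
      rw [← dist_eq_norm] at h1
      have h2 := mul_le_mul_of_nonneg_right (hsum i) hs0'
      calc dist (φ i s z) p ≤ dist (φ i s z) z + dist z p := dist_triangle _ _ _
        _ ≤ (C + ∑ i, C' i) * s := by linarith

theorem eventually_flowReach_subset (hφ : ∀ i, IsLocalFlow (v i) p (δ i) (R i) (φ i))
    (hv : ∀ i, ContDiff ℝ (⊤ : ℕ∞) (v i)) (k : ℕ) :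
    ∀ᶠ s in 𝓝[>] (0 : ℝ), ∀ i, s ∈ Icc 0 (δ i) ∧
      ∀ y ∈ flowReach φ p s k, y ∈ closedBall p (δ i) := by
  obtain ⟨C, hC0, hC⟩ := eventually_flowReach_dist_le hφ hv (mem_univ p) (by simp) k
  refine eventually_all.2 fun i => ?_
  have h1 : Tendsto (fun s : ℝ => C * s) (𝓝[>] 0) (𝓝 0) := by
    have : Tendsto (fun s : ℝ => C * s) (𝓝 0) (𝓝 (C * 0)) :=
      (continuous_const.mul continuous_id).tendsto 0
    rw [mul_zero] at this
    exact this.mono_left nhdsWithin_le_nhds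
  have h2 : Tendsto (fun s : ℝ => s) (𝓝[>] 0) (𝓝 0) := tendsto_id.mono_left nhdsWithin_le_nhds
  filter_upwards [hC, h1.eventually_le_const (hφ i).pos, h2.eventually_le_const (hφ i).pos,
    self_mem_nhdsWithin] with s hs hs1 hs2 hs0
  exact ⟨⟨le_of_lt hs0, hs2⟩, fun y hy => (hs y hy).1.trans hs1⟩

theorem VanishesToOrder.exists_flowReach_bound
    (hφ : ∀ i, IsLocalFlow (v i) p (δ i) (R i) (φ i)) (hv : ∀ i, ContDiff ℝ (⊤ : ℕ∞) (v i))
    {m : ℕ} {g : E → ℂ} (hg : ContDiff ℝ (⊤ : ℕ∞) g) (hgm : VanishesToOrder v p m g) (k : ℕ) :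
    ∃ C, 0 ≤ C ∧ ∀ᶠ s in 𝓝[>] (0 : ℝ), ∀ y ∈ flowReach φ p s k, ‖g y‖ ≤ C * s ^ m := by
  induction k generalizing m g with
  | zero =>
    rcases m with _ | m
    · refine ⟨‖g p‖, norm_nonneg _, Eventually.of_forall fun s y hy => ?_⟩
      rw [mem_singleton_iff.1 hy]
      simp
    · refine ⟨0, le_rfl, Eventually.of_forall fun s y hy => ?_⟩
      rw [mem_singleton_iff.1 hy, hgm.1]
      simp
  | succ k ih =>
    have step : ∀ i, ∃ C, 0 ≤ C ∧ ∀ᶠ s in 𝓝[>] (0 : ℝ), ∀ z ∈ flowReach φ p s k,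
        ‖g (φ i s z)‖ ≤ C * s ^ m := by
      intro i
      obtain ⟨C, hC0, hC⟩ := (hφ i).taylor (hv i) m hg
      choose B hB0 hB using fun j =>
        ih (contDiff_dirDeriv_iterate (hv i) hg j) (hgm.iterate i j)
      refine ⟨C + ∑ j ∈ Finset.range m, B j,
        add_nonneg hC0 (Finset.sum_nonneg fun j _ => hB0 j), ?_⟩
      filter_upwards [eventually_flowReach_subset hφ hv k,
        (eventually_all_finset (Finset.range m)).2 fun j _ => hB j] with s hs hsB z hz
      have hs0 := (hs i).1.1
      have h1 := hC z ((hs i).2 z hz) s (hs i).1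
      have h2 : ‖∑ j ∈ Finset.range m, (s ^ j / j.factorial) • (dirDeriv (v i))^[j] g z‖
          ≤ (∑ j ∈ Finset.range m, B j) * s ^ m := by
        rw [Finset.sum_mul]
        refine norm_sum_le_of_le _ fun j hj => ?_
        rw [norm_smul, Real.norm_of_nonneg (by positivity)]
        have hfac : (1 : ℝ) ≤ j.factorial := by exact_mod_cast j.factorial_pos
        calc s ^ j / j.factorial * ‖(dirDeriv (v i))^[j] g z‖
            ≤ s ^ j * (B j * s ^ (m - j)) := by
              gcongr
              · exact div_le_self (by positivity) hfac
              · exact hsB j hj z hz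
          _ = B j * (s ^ j * s ^ (m - j)) := by ring
          _ = B j * s ^ m := by
              rw [← pow_add, Nat.add_sub_cancel' (Finset.mem_range.1 hj).le]
      rw [add_mul]
      calc _ ≤ _ := norm_le_norm_sub_add _ _
        _ ≤ _ := add_le_add h1 h2
    choose C hC0 hC using step
    obtain ⟨C', hC'0, hC'⟩ := ih hg hgm
    refine ⟨C' + ∑ i, C i, add_nonneg hC'0 (Finset.sum_nonneg fun i _ => hC0 i), ?_⟩
    filter_upwards [hC', eventually_all.2 hC, self_mem_nhdsWithin] with s hs hsC hs0 y hy
    have hs0' : 0 ≤ s ^ m := pow_nonneg (le_of_lt hs0) m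
    rcases hy with hy | hy
    · refine (hs y hy).trans (mul_le_mul_of_nonneg_right ?_ hs0')
      exact le_add_of_nonneg_right (Finset.sum_nonneg fun i _ => hC0 i)
    · obtain ⟨i, z, hz, rfl⟩ := mem_iUnion.1 hy
      refine (hsC i z hz).trans (mul_le_mul_of_nonneg_right ?_ hs0')
      exact (Finset.single_le_sum (fun j _ => hC0 j) (Finset.mem_univ i)).trans
        (le_add_of_nonneg_left hC'0)

theorem flowDiff_sub_isBigO
    (hφ : ∀ i, IsLocalFlow (v i) p (δ i) (R i) (φ i)) (hv : ∀ i, ContDiff ℝ (⊤ : ℕ∞) (v i))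
    (w : List ι) {f : E → ℂ} (hf : ContDiff ℝ (⊤ : ℕ∞) f) :
    (fun s : ℝ => flowDiff φ s w f p -
        (s : ℂ) ^ w.length * w.foldl (fun g i => dirDeriv (v i) g) f p)
      =O[𝓝[>] 0] fun s : ℝ => s ^ (w.length + 1) := by
  induction w generalizing f with
  | nil =>
    refine (isBigO_zero (E' := ℂ) (fun s : ℝ => s ^ 1) (𝓝[>] 0)).congr_left fun s => ?_
    simp [flowDiff]
  | cons i w ih =>
    set k := w.length with hk
    have hD := fun j => contDiff_dirDeriv_iterate (hv i) hf j
    have hone : ∀ n : ℕ, (fun s : ℝ => s ^ (n + 1)) =O[𝓝[>] 0] fun s : ℝ => s ^ n := fun n => by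
      refine IsBigO.of_bound 1 ?_
      have : ∀ᶠ s : ℝ in 𝓝[>] 0, s ∈ Ioc (0 : ℝ) 1 := Ioc_mem_nhdsGT one_pos
      filter_upwards [this] with s hs
      rw [one_mul, pow_succ, norm_mul]
      exact mul_le_of_le_one_right (norm_nonneg _) (by simpa [abs_of_pos hs.1] using hs.2)
    have hbig : ∀ {g : E → ℂ}, ContDiff ℝ (⊤ : ℕ∞) g →
        (fun s : ℝ => flowDiff φ s w g p) =O[𝓝[>] 0] fun s : ℝ => s ^ k := by
      intro g hg
      have h1 : (fun s : ℝ => (s : ℂ) ^ k * w.foldl (fun g i => dirDeriv (v i) g) g p)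
          =O[𝓝[>] 0] fun s : ℝ => s ^ k := by
        simp_rw [mul_comm _ (w.foldl (fun g i => dirDeriv (v i) g) g p)]
        refine IsBigO.const_mul_left (IsBigO.of_norm_left ?_) _
        simp only [norm_pow, Complex.norm_real]
        exact (isBigO_refl _ _).norm_left.congr_left (by simp)
      simpa using ((ih hg).trans (hone k)).add h1
    obtain ⟨C, hC0, hC⟩ := (hφ i).taylor (hv i) (k + 2) hf
    set P : ℝ → E → ℂ := fun s y =>
      ∑ j ∈ Finset.range (k + 1), ((s : ℂ) ^ (j + 1) / (j + 1).factorial) *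
        (dirDeriv (v i))^[j + 1] f y with hP
    have hrem : (fun s : ℝ => flowDiff φ s w (fun y => (f (φ i s y) - f y) - P s y) p)
        =O[𝓝[>] 0] fun s : ℝ => s ^ (k + 2) := by
      refine IsBigO.of_bound (2 ^ k * C) ?_
      filter_upwards [eventually_flowReach_subset hφ hv k] with s hs
      have hs0 := (hs i).1.1
      rw [Real.norm_of_nonneg (by positivity), mul_assoc]
      refine norm_flowDiff_le fun y hy => ?_
      refine le_of_eq_of_le ?_ (hC y ((hs i).2 y hy) s (hs i).1)
      rw [Finset.sum_range_succ', hP]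
      simp [sub_sub, add_comm]
    have hsplit : ∀ s : ℝ, flowDiff φ s (i :: w) f p =
        flowDiff φ s w (fun y => (f (φ i s y) - f y) - P s y) p +
        (∑ j ∈ Finset.range k, ((s : ℂ) ^ (j + 2) / (j + 2).factorial) *
          flowDiff φ s w ((dirDeriv (v i))^[j + 2] f) p +
          s * flowDiff φ s w (dirDeriv (v i) f) p) := by
      intro s
      have h1 := flowDiff_sum (φ := φ) (Finset.range (k + 1)) s w
        (fun j => ((s : ℂ) ^ (j + 1) / (j + 1).factorial))
        (fun j => (dirDeriv (v i))^[j + 1] f) p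
      rw [Finset.sum_range_succ'] at h1
      simp only [zero_add, pow_one, Nat.factorial_one, Nat.cast_one, div_one,
        Function.iterate_one] at h1
      rw [← h1, ← flowDiff_add]
      simp only [flowDiff]
      congr 1
      ext y
      simp [hP]
    have hsum : (fun s : ℝ => ∑ j ∈ Finset.range k, ((s : ℂ) ^ (j + 2) / (j + 2).factorial) *
          flowDiff φ s w ((dirDeriv (v i))^[j + 2] f) p) =O[𝓝[>] 0] fun s : ℝ => s ^ (k + 2) := by
      refine IsBigO.fun_sum fun j _ => ?_
      have h1 : (fun s : ℝ => (s : ℂ) ^ (j + 2) / (j + 2).factorial) =O[𝓝[>] 0]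
          fun s : ℝ => s ^ 2 := by
        refine IsBigO.of_bound 1 ?_
        have : ∀ᶠ s : ℝ in 𝓝[>] 0, s ∈ Ioc (0 : ℝ) 1 := Ioc_mem_nhdsGT one_pos
        filter_upwards [this] with s hs
        have hfac : (1 : ℝ) ≤ (j + 2).factorial := by exact_mod_cast (j + 2).factorial_pos
        rw [norm_div, norm_pow, norm_pow, Complex.norm_real, Complex.norm_natCast, one_mul,
          Real.norm_of_nonneg hs.1.le]
        refine (div_le_self (pow_nonneg hs.1.le _) hfac).trans ?_
        exact pow_le_pow_of_le_one hs.1.le hs.2 (by omega)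
      exact (h1.mul (hbig (hD (j + 2)))).congr_right fun s => by ring
    have hlin : (fun s : ℝ => s * flowDiff φ s w (dirDeriv (v i) f) p -
        (s : ℂ) ^ (k + 1) * w.foldl (fun g i => dirDeriv (v i) g) (dirDeriv (v i) f) p)
        =O[𝓝[>] 0] fun s : ℝ => s ^ (k + 2) := by
      have h1 : (fun s : ℝ => (s : ℂ)) =O[𝓝[>] 0] fun s : ℝ => s :=
        IsBigO.of_bound 1 (Eventually.of_forall fun s => by simp)
      refine (h1.mul (ih (contDiff_dirDeriv (hv i) hf))).congr (fun s => ?_) fun s => ?_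
      · ring
      · ring
    refine ((hrem.add hsum).add hlin).congr (fun s => ?_) fun s => rfl
    rw [hsplit s]
    simp only [List.length_cons, List.foldl_cons]
    ring

end

/-- A smooth function whose square is dominated, on the regular level set `{ρ = 0}`, by a product of
smooth functions vanishing to orders `m` and `l` along fields tangent to `{ρ = 0}` vanishes to
every order `q < (m + l) / 2 + 1`. -/
theorem VanishesToOrder.of_sq_le [FiniteDimensional ℝ E] [Fintype ι]
    (hv : ∀ i, ContDiff ℝ (⊤ : ℕ∞) (v i)) {ρ : E → ℝ} (hρ : ContDiff ℝ (⊤ : ℕ∞) ρ)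
    (hp : ρ p = 0) (hdp : fderiv ℝ ρ p ≠ 0)
    (htan : ∀ i x, ρ x = 0 → fderiv ℝ ρ x (v i x) = 0)
    {f g h : E → ℂ} (hf : ContDiff ℝ (⊤ : ℕ∞) f) (hg : ContDiff ℝ (⊤ : ℕ∞) g)
    (hh : ContDiff ℝ (⊤ : ℕ∞) h) (hle : ∀ x, ρ x = 0 → ‖f x‖ ^ 2 ≤ ‖g x‖ * ‖h x‖)
    {m l q : ℕ} (hgm : VanishesToOrder v p m g) (hhl : VanishesToOrder v p l h)
    (hq : 2 * q < m + l + 2) : VanishesToOrder v p q f := by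
  choose R C hR hC using fun i => exists_norm_le_mul_of_eq_zero hρ hp hdp
    (contDiff_dirDeriv (hv i) hρ) (htan i)
  choose δ φ hφ using fun i => exists_isLocalFlow (hv i) p (hR i)
  refine VanishesToOrder.of_foldl fun w hw => ?_
  set k := w.length with hk
  set d : ℂ := w.foldl (fun g i => dirDeriv (v i) g) f p
  obtain ⟨A, hA0, hA⟩ := hgm.exists_flowReach_bound hφ hv hg k
  obtain ⟨B, hB0, hB⟩ := hhl.exists_flowReach_bound hφ hv hh k
  obtain ⟨_, -, hM⟩ := eventually_flowReach_dist_le hφ hv (M := {x | ρ x = 0}) hp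
    (fun i x hx hxM s hs => (hφ i).eq_zero_of_le hρ (hC i) hx hxM hs) k
  obtain ⟨K, hK⟩ := (flowDiff_sub_isBigO hφ hv w hf).bound
  have hbound : ∀ᶠ s : ℝ in 𝓝[>] 0,
      ‖d‖ ^ 2 ≤ (2 * (2 ^ k) ^ 2 * (A * B) + 2 * K ^ 2) * s := by
    have h1 : ∀ᶠ s : ℝ in 𝓝[>] 0, s ∈ Ioc (0 : ℝ) 1 := Ioc_mem_nhdsGT one_pos
    filter_upwards [hA, hB, hM, hK, h1] with s hsA hsB hsM hsK hs
    have hs0 := hs.1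
    have hF : ‖flowDiff φ s w f p‖ ≤ 2 ^ k * √(A * B * s ^ (2 * k + 1)) := by
      refine norm_flowDiff_le fun y hy => Real.le_sqrt_of_sq_le ?_
      calc ‖f y‖ ^ 2 ≤ ‖g y‖ * ‖h y‖ := hle y (hsM y hy).2
        _ ≤ (A * s ^ m) * (B * s ^ l) :=
            mul_le_mul (hsA y hy) (hsB y hy) (norm_nonneg _) (by positivity)
        _ = A * B * s ^ (m + l) := by ring
        _ ≤ A * B * s ^ (2 * k + 1) := by
            gcongr ?_ * ?_
            exact pow_le_pow_of_le_one hs0.le hs.2 (by omega)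
    have hF2 : ‖flowDiff φ s w f p‖ ^ 2 ≤ (2 ^ k) ^ 2 * (A * B * s ^ (2 * k + 1)) := by
      rw [← Real.sq_sqrt (show 0 ≤ A * B * s ^ (2 * k + 1) by positivity), ← mul_pow]
      exact pow_le_pow_left₀ (norm_nonneg _) hF 2
    rw [Real.norm_of_nonneg (by positivity : (0 : ℝ) ≤ s ^ (w.length + 1))] at hsK
    have hE2 : ‖flowDiff φ s w f p - (s : ℂ) ^ k * d‖ ^ 2 ≤ (K * s ^ (k + 1)) ^ 2 :=
      pow_le_pow_left₀ (norm_nonneg _) hsK 2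
    have htri : ‖(s : ℂ) ^ k * d‖ ≤
        ‖flowDiff φ s w f p‖ + ‖flowDiff φ s w f p - (s : ℂ) ^ k * d‖ := by
      calc ‖(s : ℂ) ^ k * d‖ =
          ‖flowDiff φ s w f p - (flowDiff φ s w f p - (s : ℂ) ^ k * d)‖ := by ring_nf
        _ ≤ _ := _root_.norm_sub_le _ _
    have hnorm : ‖(s : ℂ) ^ k * d‖ = s ^ k * ‖d‖ := by
      rw [norm_mul, norm_pow, Complex.norm_real, Real.norm_of_nonneg hs0.le]
    rw [hnorm] at htri
    have hsq : (s ^ k * ‖d‖) ^ 2 ≤ 2 * ‖flowDiff φ s w f p‖ ^ 2 +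
        2 * ‖flowDiff φ s w f p - (s : ℂ) ^ k * d‖ ^ 2 := by
      refine (pow_le_pow_left₀ (by positivity) htri 2).trans ?_
      nlinarith [sq_nonneg (‖flowDiff φ s w f p‖ - ‖flowDiff φ s w f p - (s : ℂ) ^ k * d‖)]
    have hpow : s ^ (2 * k + 2) ≤ s ^ (2 * k + 1) :=
      pow_le_pow_of_le_one hs0.le hs.2 (by omega)
    have hmain : s ^ (2 * k) * ‖d‖ ^ 2 ≤
        s ^ (2 * k) * ((2 * (2 ^ k) ^ 2 * (A * B) + 2 * K ^ 2) * s) := by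
      have e1 : (s ^ k * ‖d‖) ^ 2 = s ^ (2 * k) * ‖d‖ ^ 2 := by ring
      have e2 : (K * s ^ (k + 1)) ^ 2 = K ^ 2 * s ^ (2 * k + 2) := by ring
      have e3 : s ^ (2 * k) * ((2 * (2 ^ k) ^ 2 * (A * B) + 2 * K ^ 2) * s) =
        2 * ((2 ^ k) ^ 2 * (A * B * s ^ (2 * k + 1))) + 2 * (K ^ 2 * s ^ (2 * k + 1)) := by ring
      rw [e1] at hsq
      rw [e2] at hE2
      rw [e3]
      have := mul_le_mul_of_nonneg_left hpow (sq_nonneg K)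
      linarith
    exact le_of_mul_le_mul_left hmain (by positivity)
  have hlim : Tendsto (fun s : ℝ => (2 * (2 ^ k) ^ 2 * (A * B) + 2 * K ^ 2) * s) (𝓝[>] 0)
      (𝓝 0) := by
    have : Tendsto (fun s : ℝ => (2 * (2 ^ k) ^ 2 * (A * B) + 2 * K ^ 2) * s) (𝓝 0)
      (𝓝 ((2 * (2 ^ k) ^ 2 * (A * B) + 2 * K ^ 2) * 0)) :=
      (continuous_const.mul continuous_id).tendsto 0
    rw [mul_zero] at this
    exact this.mono_left nhdsWithin_le_nhds
  have hd : ‖d‖ ^ 2 ≤ 0 := ge_of_tendsto hlim hbound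
  have : ‖d‖ ^ 2 = 0 := le_antisymm hd (sq_nonneg _)
  simpa using this

end VanishingOrder

section LevelSet

variable {E ι : Type*} [NormedAddCommGroup E] [NormedSpace ℝ E] {ρ : E → ℝ} {f g : E → ℂ} {x : E}

/-- The differential of a smooth function that is real and nonnegative on a regular level set is,
at a zero lying on the level set, a multiple of the differential of the defining function. -/
theorem exists_fderiv_eq_mul_of_nonneg [CompleteSpace E] (hρ : ContDiff ℝ (⊤ : ℕ∞) ρ)
    (hx : ρ x = 0) (hdx : fderiv ℝ ρ x ≠ 0) (hf : ContDiff ℝ (⊤ : ℕ∞) f)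
    (hre : ∀ y, ρ y = 0 → 0 ≤ (f y).re) (him : ∀ y, ρ y = 0 → (f y).im = 0) (hfx : f x = 0) :
    ∃ c : ℂ, ∀ w, fderiv ℝ f x w = c * fderiv ℝ ρ x w := by
  have hstrict : HasStrictFDerivAt ρ (fderiv ℝ ρ x) x :=
    hρ.contDiffAt.hasStrictFDerivAt (by simp)
  have key : ∀ T : ℂ →L[ℝ] ℝ, (∀ y, ρ y = 0 → 0 ≤ T (f y)) →
      ∃ c : ℝ, ∀ w, T (fderiv ℝ f x w) = c * fderiv ℝ ρ x w := by
    intro T hT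
    have hTf : HasStrictFDerivAt (fun y => T (f y)) (T.comp (fderiv ℝ f x)) x :=
      T.hasStrictFDerivAt.comp x (hf.contDiffAt.hasStrictFDerivAt (by simp))
    have hext : IsLocalExtrOn (fun y => T (f y)) {y | ρ y = ρ x} x := by
      refine Or.inl (IsMinOn.localize fun y hy => ?_)
      change T (f x) ≤ T (f y)
      rw [hfx, map_zero]
      exact hT y (hy.trans hx)
    obtain ⟨Λ, β, hΛβ, h⟩ := hext.exists_linear_map_of_hasStrictFDerivAt hstrict hTf
    have hΛ : ∀ t, Λ t = t * Λ 1 := fun t => by simpa using Λ.map_smul t 1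
    have h' : ∀ w, fderiv ℝ ρ x w * Λ 1 + β * T (fderiv ℝ f x w) = 0 := fun w => by
      simpa [hΛ (fderiv ℝ ρ x w)] using h w
    have hβ : β ≠ 0 := by
      rintro rfl
      have hα : Λ 1 ≠ 0 := fun h0 =>
        hΛβ (Prod.ext (LinearMap.ext fun t => by simp [hΛ t, h0]) rfl)
      refine hdx (ContinuousLinearMap.ext fun w => ?_)
      simpa [hα] using h' w
    refine ⟨-(Λ 1 / β), fun w => ?_⟩
    have hw := h' w
    field_simp
    linarith
  obtain ⟨c, hc⟩ := key Complex.reCLM hre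
  obtain ⟨d, hd⟩ := key Complex.imCLM fun y hy => (him y hy).ge
  refine ⟨c + d * Complex.I, fun w => Complex.ext ?_ ?_⟩
  · simpa using hc w
  · simpa using hd w

theorem dirDeriv_mul (hf : ContDiff ℝ (⊤ : ℕ∞) f) (hg : ContDiff ℝ (⊤ : ℕ∞) g) (v : E → E) :
    dirDeriv v (fun x => g x * f x) = fun x => g x * dirDeriv v f x + dirDeriv v g x * f x := by
  ext x
  simp only [dirDeriv]
  rw [fderiv_fun_mul (hg.differentiable (by simp)).differentiableAt
    (hf.differentiable (by simp)).differentiableAt]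
  simp [mul_comm]

theorem fderiv_star_apply (hf : ContDiff ℝ (⊤ : ℕ∞) f) (x w : E) :
    fderiv ℝ (fun x => starRingEnd ℂ (f x)) x w = starRingEnd ℂ (fderiv ℝ f x w) := by
  have h := (Complex.conjCLE.toContinuousLinearMap.hasFDerivAt (x := f x)).comp x
    (hf.differentiable (by simp)).differentiableAt.hasFDerivAt
  have h' : fderiv ℝ (fun x => starRingEnd ℂ (f x)) x = _ := h.fderiv
  rw [h']
  rfl

theorem contDiff_star (hf : ContDiff ℝ (⊤ : ℕ∞) f) :
    ContDiff ℝ (⊤ : ℕ∞) fun x => starRingEnd ℂ (f x) :=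
  Complex.conjCLE.contDiff.comp hf

namespace VanishesToOrder

variable {v : ι → E → E} {p : E} {m : ℕ}

theorem add (hf : ContDiff ℝ (⊤ : ℕ∞) f) (hg : ContDiff ℝ (⊤ : ℕ∞) g)
    (hv : ∀ i, ContDiff ℝ (⊤ : ℕ∞) (v i)) (hfm : VanishesToOrder v p m f)
    (hgm : VanishesToOrder v p m g) : VanishesToOrder v p m fun x => f x + g x := by
  induction m generalizing f g with
  | zero => trivial
  | succ m ih =>
    refine ⟨by simp [hfm.1, hgm.1], fun i => ?_⟩
    have : dirDeriv (v i) (fun x => f x + g x) =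
        fun x => dirDeriv (v i) f x + dirDeriv (v i) g x := by
      ext x
      simp only [dirDeriv]
      rw [fderiv_fun_add (hf.differentiable (by simp)).differentiableAt
        (hg.differentiable (by simp)).differentiableAt]
      rfl
    rw [this]
    exact ih (contDiff_dirDeriv (hv i) hf) (contDiff_dirDeriv (hv i) hg) (hfm.2 i) (hgm.2 i)

theorem mul_left (hf : ContDiff ℝ (⊤ : ℕ∞) f) (hg : ContDiff ℝ (⊤ : ℕ∞) g)
    (hv : ∀ i, ContDiff ℝ (⊤ : ℕ∞) (v i)) (hfm : VanishesToOrder v p m f) :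
    VanishesToOrder v p m fun x => g x * f x := by
  induction m generalizing f g with
  | zero => trivial
  | succ m ih =>
    refine ⟨by simp [hfm.1], fun i => ?_⟩
    have hDf := contDiff_dirDeriv (hv i) hf
    have hDg := contDiff_dirDeriv (hv i) hg
    rw [dirDeriv_mul hf hg]
    exact add (hg.mul hDf) (hDg.mul hf) hv (ih hDf hg (hfm.2 i))
      (ih hf hDg (hfm.mono m.le_succ))

theorem sub (hf : ContDiff ℝ (⊤ : ℕ∞) f) (hg : ContDiff ℝ (⊤ : ℕ∞) g)
    (hv : ∀ i, ContDiff ℝ (⊤ : ℕ∞) (v i)) (hfm : VanishesToOrder v p m f)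
    (hgm : VanishesToOrder v p m g) : VanishesToOrder v p m fun x => f x - g x := by
  simpa [sub_eq_add_neg] using
    hfm.add hf (contDiff_const (c := (-1 : ℂ)).mul hg) hv (hgm.mul_left hg contDiff_const hv)

theorem of_mul_left (hf : ContDiff ℝ (⊤ : ℕ∞) f) (hg : ContDiff ℝ (⊤ : ℕ∞) g)
    (hv : ∀ i, ContDiff ℝ (⊤ : ℕ∞) (v i)) (hgp : g p ≠ 0)
    (h : VanishesToOrder v p m fun x => g x * f x) : VanishesToOrder v p m f := by
  induction m generalizing f with
  | zero => trivial
  | succ m ih =>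
    refine ⟨(mul_eq_zero.1 h.1).resolve_left hgp, fun i => ?_⟩
    have hDf := contDiff_dirDeriv (hv i) hf
    have hDg := contDiff_dirDeriv (hv i) hg
    have h1 := h.2 i
    rw [dirDeriv_mul hf hg] at h1
    refine ih hDf ?_
    have h2 := (ih hf (h.mono m.le_succ)).mul_left hf hDg hv
    simpa using h1.sub ((hg.mul hDf).add (hDg.mul hf)) (hDg.mul hf) hv h2

theorem star (hf : ContDiff ℝ (⊤ : ℕ∞) f) (hv : ∀ i, ContDiff ℝ (⊤ : ℕ∞) (v i))
    (hfm : VanishesToOrder v p m f) :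
    VanishesToOrder v p m fun x => starRingEnd ℂ (f x) := by
  induction m generalizing f with
  | zero => trivial
  | succ m ih =>
    refine ⟨by simp [hfm.1], fun i => ?_⟩
    have : dirDeriv (v i) (fun x => starRingEnd ℂ (f x)) =
        fun x => starRingEnd ℂ (dirDeriv (v i) f x) := by
      ext x
      exact fderiv_star_apply hf x _
    rw [this]
    exact ih (contDiff_dirDeriv (hv i) hf) (hfm.2 i)

theorem congr_of_eqOn [CompleteSpace E] (hρ : ContDiff ℝ (⊤ : ℕ∞) ρ)
    (hreg : ∀ x, ρ x = 0 → fderiv ℝ ρ x ≠ 0)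
    (hv : ∀ i, ContDiff ℝ (⊤ : ℕ∞) (v i))
    (htan : ∀ i x, ρ x = 0 → fderiv ℝ ρ x (v i x) = 0)
    (hf : ContDiff ℝ (⊤ : ℕ∞) f) (hg : ContDiff ℝ (⊤ : ℕ∞) g) (hp : ρ p = 0)
    (hfg : ∀ x, ρ x = 0 → f x = g x) (hfm : VanishesToOrder v p m f) :
    VanishesToOrder v p m g := by
  induction m generalizing f g with
  | zero => trivial
  | succ m ih =>
    refine ⟨hfg p hp ▸ hfm.1, fun i => ?_⟩
    refine ih (contDiff_dirDeriv (hv i) hf) (contDiff_dirDeriv (hv i) hg) (fun x hx => ?_) (hfm.2 i)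
    obtain ⟨c, hc⟩ := exists_fderiv_eq_mul_of_nonneg hρ hx (hreg x hx) (hf.sub hg)
      (fun y hy => by simp [hfg y hy]) (fun y hy => by simp [hfg y hy]) (by simp [hfg x hx])
    have h1 := hc (v i x)
    rw [htan i x hx, fderiv_fun_sub (hf.differentiable (by simp)).differentiableAt
        (hg.differentiable (by simp)).differentiableAt] at h1
    simpa [sub_eq_zero, dirDeriv] using h1

end VanishesToOrder

end LevelSet

section Wirtinger

variable {n : ℕ} {f g : Cn n → ℂ} {ρ : Cn n → ℝ}

/-- The coefficients of a mixed-type field with respect to all the `∂/∂z_j`, `∂/∂z̄_j`. -/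
def CVF.coef (W : CVF n) : Fin n ⊕ Fin n → Cn n → ℂ := Sum.elim W.hol W.anti

/-- All Wirtinger derivatives: `∂/∂z_j` for `Sum.inl j` and `∂/∂z̄_j` for `Sum.inr j`. -/
noncomputable def wirt (i : Fin n ⊕ Fin n) (f : Cn n → ℂ) (x : Cn n) : ℂ :=
  Sum.elim (fun j => wz j f x) (fun j => wzb j f x) i

theorem CVF.act_eq_sum (W : CVF n) (f : Cn n → ℂ) (x : Cn n) :
    W.act f x = ∑ i, W.coef i x * wirt i f x := by
  simp [CVF.act, CVF.coef, wirt]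

theorem CVF.bracket_coef (V W : CVF n) (i : Fin n ⊕ Fin n) (x : Cn n) :
    (V.bracket W).coef i x = V.act (W.coef i) x - W.act (V.coef i) x := by
  cases i <;> rfl

/-- All coefficients of the field are smooth. -/
def CVF.IsSmooth (W : CVF n) : Prop := ∀ i, ContDiff ℝ (⊤ : ℕ∞) (W.coef i)

theorem contDiff_fderiv_const (hf : ContDiff ℝ (⊤ : ℕ∞) f) (w : Cn n) :
    ContDiff ℝ (⊤ : ℕ∞) fun x => fderiv ℝ f x w :=
  contDiff_dirDeriv (v := fun _ => w) contDiff_const hf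

theorem contDiff_wirt (hf : ContDiff ℝ (⊤ : ℕ∞) f) (i : Fin n ⊕ Fin n) :
    ContDiff ℝ (⊤ : ℕ∞) (wirt i f) := by
  rcases i with j | j
  · exact ((contDiff_fderiv_const hf _).sub
      (contDiff_const.mul (contDiff_fderiv_const hf _))).div_const 2
  · exact ((contDiff_fderiv_const hf _).add
      (contDiff_const.mul (contDiff_fderiv_const hf _))).div_const 2

theorem contDiff_wz (hf : ContDiff ℝ (⊤ : ℕ∞) f) (j : Fin n) : ContDiff ℝ (⊤ : ℕ∞) (wz j f) :=
  contDiff_wirt hf (Sum.inl j)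

theorem contDiff_wzb (hf : ContDiff ℝ (⊤ : ℕ∞) f) (j : Fin n) : ContDiff ℝ (⊤ : ℕ∞) (wzb j f) :=
  contDiff_wirt hf (Sum.inr j)

theorem CVF.contDiff_act {W : CVF n} (hW : W.IsSmooth) (hf : ContDiff ℝ (⊤ : ℕ∞) f) :
    ContDiff ℝ (⊤ : ℕ∞) (W.act f) := by
  have : W.act f = fun x => ∑ i, W.coef i x * wirt i f x := funext fun x => W.act_eq_sum f x
  rw [this]
  exact ContDiff.sum fun i _ => (hW i).mul (contDiff_wirt hf i)

theorem CVF.IsSmooth.bracket {V W : CVF n} (hV : V.IsSmooth) (hW : W.IsSmooth) :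
    (V.bracket W).IsSmooth := fun i => by
  have : (V.bracket W).coef i = fun x => V.act (W.coef i) x - W.act (V.coef i) x :=
    funext fun x => V.bracket_coef W i x
  rw [this]
  exact (CVF.contDiff_act hV (hW i)).sub (CVF.contDiff_act hW (hV i))

theorem wirt_mul (hf : ContDiff ℝ (⊤ : ℕ∞) f) (hg : ContDiff ℝ (⊤ : ℕ∞) g) (i : Fin n ⊕ Fin n)
    (x : Cn n) : wirt i (fun x => f x * g x) x = wirt i f x * g x + f x * wirt i g x := by
  have h := fderiv_fun_mul (hf.differentiable (by simp)).differentiableAt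
    (hg.differentiable (by simp)).differentiableAt (x := x) (𝕜 := ℝ)
  rcases i with j | j <;> simp only [wirt, wz, wzb, Sum.elim_inl, Sum.elim_inr, h] <;> simp <;> ring

theorem wirt_sum {α : Type*} (s : Finset α) {F : α → Cn n → ℂ}
    (hF : ∀ k, ContDiff ℝ (⊤ : ℕ∞) (F k)) (i : Fin n ⊕ Fin n) (x : Cn n) :
    wirt i (fun x => ∑ k ∈ s, F k x) x = ∑ k ∈ s, wirt i (F k) x := by
  have h := fderiv_fun_sum (𝕜 := ℝ) (u := s) (x := x) (A := F)
    fun k _ => ((hF k).differentiable (by simp)).differentiableAt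
  rcases i with j | j <;>
    simp only [wirt, wz, wzb, Sum.elim_inl, Sum.elim_inr, h, sum_apply,
      Finset.mul_sum, ← Finset.sum_sub_distrib, ← Finset.sum_add_distrib, Finset.sum_div]

theorem fderiv_fderiv_comm (hf : ContDiff ℝ (⊤ : ℕ∞) f) (x v w : Cn n) :
    fderiv ℝ (fun y => fderiv ℝ f y v) x w = fderiv ℝ (fun y => fderiv ℝ f y w) x v := by
  have hd : DifferentiableAt ℝ (fderiv ℝ f) x :=
    ((hf.fderiv_right (m := (⊤ : ℕ∞)) (by simp)).differentiable (by simp)).differentiableAt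
  have h : ∀ u, fderiv ℝ (fun y => fderiv ℝ f y u) x = (fderiv ℝ (fderiv ℝ f) x).flip u := by
    intro u
    rw [fderiv_clm_apply hd (differentiableAt_const u)]
    simp
  rw [h, h]
  have hsymm : IsSymmSndFDerivAt ℝ f x :=
    (hf.contDiffAt).isSymmSndFDerivAt (by
      rw [minSmoothness_of_isRCLikeNormedField]
      exact WithTop.coe_le_coe.2 (le_top (a := (2 : ℕ∞))))
  exact hsymm w v

theorem wirt_comm (hf : ContDiff ℝ (⊤ : ℕ∞) f) (i k : Fin n ⊕ Fin n) (x : Cn n) :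
    wirt i (wirt k f) x = wirt k (wirt i f) x := by
  have hd : ∀ w, DifferentiableAt ℝ (fun y => fderiv ℝ f y w) x := fun w =>
    ((contDiff_fderiv_const hf w).differentiable (by simp)).differentiableAt
  have hz : ∀ j w, fderiv ℝ (wz j f) x w = (fderiv ℝ (fun y => fderiv ℝ f y w) x (Pi.single j 1) -
      Complex.I * fderiv ℝ (fun y => fderiv ℝ f y w) x (Pi.single j Complex.I)) / 2 := by
    intro j w
    have h := (((hd (Pi.single j 1)).hasFDerivAt.sub
      ((hd (Pi.single j Complex.I)).hasFDerivAt.const_mul Complex.I)).mul_const (2⁻¹ : ℂ)).fderiv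
    have h' : fderiv ℝ (wz j f) x = _ := h
    rw [h', fderiv_fderiv_comm hf x w, fderiv_fderiv_comm hf x w]
    simp [div_eq_inv_mul]
  have hzb : ∀ j w, fderiv ℝ (wzb j f) x w =
      (fderiv ℝ (fun y => fderiv ℝ f y w) x (Pi.single j 1) +
      Complex.I * fderiv ℝ (fun y => fderiv ℝ f y w) x (Pi.single j Complex.I)) / 2 := by
    intro j w
    have h := (((hd (Pi.single j 1)).hasFDerivAt.add
      ((hd (Pi.single j Complex.I)).hasFDerivAt.const_mul Complex.I)).mul_const (2⁻¹ : ℂ)).fderiv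
    have h' : fderiv ℝ (wzb j f) x = _ := h
    rw [h', fderiv_fderiv_comm hf x w, fderiv_fderiv_comm hf x w]
    simp [div_eq_inv_mul, mul_add]
  have hl : ∀ j, wirt (Sum.inl j) f = wz j f := fun _ => rfl
  have hr : ∀ j, wirt (Sum.inr j) f = wzb j f := fun _ => rfl
  have hl' : ∀ j (g : Cn n → ℂ), wirt (Sum.inl j) g x = (fderiv ℝ g x (Pi.single j 1) -
      Complex.I * fderiv ℝ g x (Pi.single j Complex.I)) / 2 := fun _ _ => rfl
  have hr' : ∀ j (g : Cn n → ℂ), wirt (Sum.inr j) g x = (fderiv ℝ g x (Pi.single j 1) +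
      Complex.I * fderiv ℝ g x (Pi.single j Complex.I)) / 2 := fun _ _ => rfl
  rcases i with i | i <;> rcases k with k | k <;>
    simp only [hl', hr', hl, hr, hz, hzb, fderiv_fderiv_comm hf x (Pi.single i _)] <;>
    ring

theorem wz_star (hf : ContDiff ℝ (⊤ : ℕ∞) f) (j : Fin n) (x : Cn n) :
    wz j (fun x => starRingEnd ℂ (f x)) x = starRingEnd ℂ (wzb j f x) := by
  simp only [wz, wzb, fderiv_star_apply hf]
  simp [sub_eq_add_neg, Complex.conj_ofNat]

theorem wzb_star (hf : ContDiff ℝ (⊤ : ℕ∞) f) (j : Fin n) (x : Cn n) :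
    wzb j (fun x => starRingEnd ℂ (f x)) x = starRingEnd ℂ (wz j f x) := by
  simp only [wz, wzb, fderiv_star_apply hf]
  simp [sub_eq_add_neg, Complex.conj_ofNat]

theorem fderiv_apply_eq_sum (f : Cn n → ℂ) (x w : Cn n) :
    fderiv ℝ f x w = ∑ j, w j * wz j f x + ∑ j, starRingEnd ℂ (w j) * wzb j f x := by
  have hw : w = ∑ j, ((w j).re • (Pi.single j 1 : Cn n) + (w j).im • (Pi.single j Complex.I : Cn n)) := by
    ext k
    simp [Finset.sum_apply, Pi.single_apply, Finset.sum_add_distrib]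
  conv_lhs => rw [hw]
  rw [map_sum, ← Finset.sum_add_distrib]
  refine Finset.sum_congr rfl fun j _ => ?_
  rw [map_add, map_smul, map_smul]
  simp only [wz, wzb, Complex.real_smul]
  have h2 : starRingEnd ℂ (w j) = (w j).re - (w j).im * Complex.I := by
    apply Complex.ext <;> simp
  linear_combination
    -(fderiv ℝ f x (Pi.single j 1) - Complex.I * fderiv ℝ f x (Pi.single j Complex.I)) / 2 *
      (Complex.re_add_im (w j)).symm -
    (fderiv ℝ f x (Pi.single j 1) + Complex.I * fderiv ℝ f x (Pi.single j Complex.I)) / 2 * h2 +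
    ((w j).im : ℂ) * (fderiv ℝ f x (Pi.single j Complex.I)) * Complex.I_sq

end Wirtinger

section Levi

variable {n : ℕ} {f g : Cn n → ℂ} {ρ : Cn n → ℝ} {x : Cn n}

namespace CVF

theorem act_sum_mul {α : Type*} [Fintype α] (V : CVF n) {F G : α → Cn n → ℂ}
    (hF : ∀ k, ContDiff ℝ (⊤ : ℕ∞) (F k)) (hG : ∀ k, ContDiff ℝ (⊤ : ℕ∞) (G k)) (x : Cn n) :
    V.act (fun x => ∑ k, F k x * G k x) x =
      ∑ k, (V.act (F k) x * G k x + F k x * V.act (G k) x) := by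
  simp only [act_eq_sum]
  simp only [wirt_sum _ fun k => (hF k).mul (hG k), wirt_mul (hF _) (hG _), Finset.mul_sum,
    Finset.sum_mul]
  rw [Finset.sum_comm]
  refine Finset.sum_congr rfl fun k _ => ?_
  rw [← Finset.sum_add_distrib]
  exact Finset.sum_congr rfl fun i _ => by ring

theorem act_act {V W : CVF n} (hW : W.IsSmooth) (hf : ContDiff ℝ (⊤ : ℕ∞) f) (x : Cn n) :
    V.act (W.act f) x = ∑ i, V.act (W.coef i) x * wirt i f x +
      ∑ i, ∑ k, W.coef i x * V.coef k x * wirt k (wirt i f) x := by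
  have : W.act f = fun x => ∑ i, W.coef i x * wirt i f x := funext fun x => W.act_eq_sum f x
  rw [this, act_sum_mul V hW (contDiff_wirt hf), Finset.sum_add_distrib]
  congr 1
  refine Finset.sum_congr rfl fun i _ => ?_
  rw [act_eq_sum, Finset.mul_sum]
  exact Finset.sum_congr rfl fun k _ => by ring

theorem bracket_act {V W : CVF n} (hV : V.IsSmooth) (hW : W.IsSmooth)
    (hf : ContDiff ℝ (⊤ : ℕ∞) f) (x : Cn n) :
    (V.bracket W).act f x = V.act (W.act f) x - W.act (V.act f) x := by
  rw [act_act hW hf, act_act hV hf, act_eq_sum, Finset.sum_comm (γ := Fin n ⊕ Fin n)]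
  simp only [bracket_coef, sub_mul, Finset.sum_sub_distrib, wirt_comm hf, mul_comm (V.coef _ x)]
  ring

end CVF

theorem contDiff_cx (hρ : ContDiff ℝ (⊤ : ℕ∞) ρ) : ContDiff ℝ (⊤ : ℕ∞) (cx ρ) :=
  Complex.ofRealCLM.contDiff.comp hρ

theorem fderiv_cx (hρ : ContDiff ℝ (⊤ : ℕ∞) ρ) (x w : Cn n) :
    fderiv ℝ (cx ρ) x w = fderiv ℝ ρ x w := by
  have h : fderiv ℝ (cx ρ) x = _ := (Complex.ofRealCLM.hasFDerivAt.comp x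
    (hρ.differentiable (by simp)).differentiableAt.hasFDerivAt).fderiv
  rw [h]
  rfl

theorem star_wzb_cx (hρ : ContDiff ℝ (⊤ : ℕ∞) ρ) (j : Fin n) (x : Cn n) :
    starRingEnd ℂ (wzb j (cx ρ) x) = wz j (cx ρ) x := by
  rw [← wz_star (contDiff_cx hρ)]
  simp only [cx, Complex.conj_ofReal]
  rfl

theorem star_wz_cx (hρ : ContDiff ℝ (⊤ : ℕ∞) ρ) (j : Fin n) (x : Cn n) :
    starRingEnd ℂ (wz j (cx ρ) x) = wzb j (cx ρ) x := by
  rw [← star_wzb_cx hρ, Complex.conj_conj]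

theorem CVF.act_eq_zero_of_nonneg (hρ : ContDiff ℝ (⊤ : ℕ∞) ρ) (hx : ρ x = 0)
    (hdx : fderiv ℝ ρ x ≠ 0) (hf : ContDiff ℝ (⊤ : ℕ∞) f)
    (hre : ∀ y, ρ y = 0 → 0 ≤ (f y).re) (him : ∀ y, ρ y = 0 → (f y).im = 0) (hfx : f x = 0)
    {W : CVF n} (hW : W.act (cx ρ) x = 0) : W.act f x = 0 := by
  obtain ⟨c, hc⟩ := exists_fderiv_eq_mul_of_nonneg hρ hx hdx hf hre him hfx
  have h : ∀ i, wirt i f x = c * wirt i (cx ρ) x := by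
    rintro (j | j) <;> simp only [wirt, wz, wzb, Sum.elim_inl, Sum.elim_inr, hc, fderiv_cx hρ] <;>
      ring
  have : W.act f x = c * W.act (cx ρ) x := by
    simp only [CVF.act_eq_sum, h, Finset.mul_sum]
    exact Finset.sum_congr rfl fun i _ => by ring
  rw [this, hW, mul_zero]

theorem contDiff_leviCoeff (hρ : ContDiff ℝ (⊤ : ℕ∞) ρ) (j l : Fin n) :
    ContDiff ℝ (⊤ : ℕ∞) (leviCoeff ρ j l) :=
  contDiff_wz (contDiff_wzb (contDiff_cx hρ) l) j

theorem wzb_wz_cx (hρ : ContDiff ℝ (⊤ : ℕ∞) ρ) (j l : Fin n) (x : Cn n) :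
    wzb l (wz j (cx ρ)) x = leviCoeff ρ j l x :=
  (wirt_comm (contDiff_cx hρ) (Sum.inl j) (Sum.inr l) x).symm

theorem star_leviCoeff (hρ : ContDiff ℝ (⊤ : ℕ∞) ρ) (j l : Fin n) (x : Cn n) :
    starRingEnd ℂ (leviCoeff ρ j l x) = leviCoeff ρ l j x := by
  have h : (fun y => starRingEnd ℂ (wzb l (cx ρ) y)) = wz l (cx ρ) :=
    funext fun y => star_wzb_cx hρ l y
  rw [← wzb_wz_cx hρ l j, ← h, wzb_star (contDiff_wzb (contDiff_cx hρ) l)]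
  rfl

theorem wzb_leviCoeff_comm (hρ : ContDiff ℝ (⊤ : ℕ∞) ρ) (j k l : Fin n) (x : Cn n) :
    wzb l (leviCoeff ρ j k) x = wzb k (leviCoeff ρ j l) x := by
  have h : ∀ k, leviCoeff ρ j k = wirt (Sum.inr k) (wz j (cx ρ)) := fun k =>
    funext fun y => (wzb_wz_cx hρ j k y).symm
  rw [h, h]
  exact wirt_comm (contDiff_wz (contDiff_cx hρ) j) (Sum.inr l) (Sum.inr k) x

variable {a ξ η ζ : Fin n → Cn n → ℂ}

theorem contDiff_levi (hρ : ContDiff ℝ (⊤ : ℕ∞) ρ) (hξ : ∀ j, ContDiff ℝ (⊤ : ℕ∞) (ξ j))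
    (hη : ∀ j, ContDiff ℝ (⊤ : ℕ∞) (η j)) : ContDiff ℝ (⊤ : ℕ∞) (levi ρ ξ η) :=
  ContDiff.sum fun j _ => ContDiff.sum fun l _ =>
    ((contDiff_leviCoeff hρ j l).mul (hξ j)).mul (contDiff_star (hη l))

theorem star_levi (hρ : ContDiff ℝ (⊤ : ℕ∞) ρ) (ξ η : Fin n → Cn n → ℂ) (x : Cn n) :
    starRingEnd ℂ (levi ρ ξ η x) = levi ρ η ξ x := by
  simp only [levi, map_sum, map_mul, star_leviCoeff hρ, Complex.conj_conj]
  rw [Finset.sum_comm]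
  exact Finset.sum_congr rfl fun j _ => Finset.sum_congr rfl fun l _ => by ring

theorem levi_self_im (hρ : ContDiff ℝ (⊤ : ℕ∞) ρ) (ξ : Fin n → Cn n → ℂ) (x : Cn n) :
    (levi ρ ξ ξ x).im = 0 :=
  Complex.conj_eq_iff_im.1 (star_levi hρ ξ ξ x)

theorem levi_comb_left (ρ : Cn n → ℝ) (ξ η ζ : Fin n → Cn n → ℂ) (α β : Cn n → ℂ) (x : Cn n) :
    levi ρ (fun j x => α x * ξ j x + β x * η j x) ζ x =
      α x * levi ρ ξ ζ x + β x * levi ρ η ζ x := by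
  simp only [levi, Finset.mul_sum, ← Finset.sum_add_distrib]
  exact Finset.sum_congr rfl fun j _ => Finset.sum_congr rfl fun l _ => by ring

theorem levi_comb_right (ρ : Cn n → ℝ) (ξ η ζ : Fin n → Cn n → ℂ) (α β : Cn n → ℂ) (x : Cn n) :
    levi ρ ζ (fun j x => α x * ξ j x + β x * η j x) x =
      starRingEnd ℂ (α x) * levi ρ ζ ξ x + starRingEnd ℂ (β x) * levi ρ ζ η x := by
  simp only [levi, Finset.mul_sum, ← Finset.sum_add_distrib, map_add, map_mul]
  exact Finset.sum_congr rfl fun j _ => Finset.sum_congr rfl fun l _ => by ring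

/-- Cauchy–Schwarz for the Levi form on the CR directions at a point of a pseudoconvex
hypersurface. -/
theorem Pseudoconvex.sq_norm_levi_le {M : Set (Cn n)} (hpsc : Pseudoconvex ρ M)
    (hρ : ContDiff ℝ (⊤ : ℕ∞) ρ) (hx : x ∈ M) (hξ : ∑ j, ξ j x * wz j (cx ρ) x = 0)
    (hη : ∑ j, η j x * wz j (cx ρ) x = 0) :
    ‖levi ρ ξ η x‖ ^ 2 ≤ (levi ρ ξ ξ x).re * (levi ρ η η x).re := by
  set A := (levi ρ ξ ξ x).re with hA
  set B := (levi ρ η η x).re with hB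
  set h := levi ρ ξ η x with hh
  have hA0 : 0 ≤ A := hpsc x hx (fun j => ξ j x) hξ
  have hB0 : 0 ≤ B := hpsc x hx (fun j => η j x) hη
  have key : ∀ t : ℝ, 0 ≤ ‖h‖ ^ 2 * B * (t * t) + -2 * ‖h‖ ^ 2 * t + A := by
    intro t
    have h1 : 0 ≤ (levi ρ (fun j x => 1 * ξ j x + (-t * h) * η j x)
        (fun j x => 1 * ξ j x + (-t * h) * η j x) x).re := by
      refine hpsc x hx (fun j => 1 * ξ j x + (-t * h) * η j x) ?_
      simp only [one_mul, add_mul, Finset.sum_add_distrib, hξ, mul_assoc, ← Finset.mul_sum, hη]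
      simp
    rw [levi_comb_left ρ ξ η _ (fun _ => 1) (fun _ => -t * h),
      levi_comb_right ρ ξ η _ (fun _ => 1) (fun _ => -t * h),
      levi_comb_right ρ ξ η _ (fun _ => 1) (fun _ => -t * h), ← star_levi hρ ξ η, ← hh] at h1
    have e1 : levi ρ ξ ξ x = A := Complex.ext rfl (by simpa using levi_self_im hρ ξ x)
    have e2 : levi ρ η η x = B := Complex.ext rfl (by simpa using levi_self_im hρ η x)
    rw [e1, e2] at h1
    rw [← Complex.normSq_eq_norm_sq, Complex.normSq_apply]
    simp at h1
    linarith
  have hd := discrim_le_zero key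
  rw [discrim] at hd
  rcases eq_or_lt_of_le (sq_nonneg ‖h‖) with h0 | h0
  · rw [← h0]
    positivity
  · nlinarith

theorem pairDRho_bracket (hρ : ContDiff ℝ (⊤ : ℕ∞) ρ) {V W : CVF n} (hV : V.IsSmooth)
    (hW : W.IsSmooth) (x : Cn n) :
    pairDRho ρ (V.bracket W) x = V.act (pairDRho ρ W) x - W.act (pairDRho ρ V) x +
      (∑ j, ∑ k, leviCoeff ρ j k x * V.hol j x * W.anti k x -
        ∑ j, ∑ k, leviCoeff ρ j k x * W.hol j x * V.anti k x) := by
  have hpair : ∀ {V W : CVF n}, W.IsSmooth → V.act (pairDRho ρ W) x =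
      ∑ j, V.act (W.hol j) x * wz j (cx ρ) x +
        (∑ j, ∑ k, W.hol j x * V.hol k x * wz k (wz j (cx ρ)) x +
          ∑ j, ∑ k, leviCoeff ρ j k x * W.hol j x * V.anti k x) := by
    intro V W hW
    have := V.act_sum_mul (fun j => hW (Sum.inl j)) (fun j => contDiff_wz (contDiff_cx hρ) j) x
    refine this.trans ?_
    rw [Finset.sum_add_distrib, ← Finset.sum_add_distrib (f := fun j => ∑ k, _)]
    congr 1
    refine Finset.sum_congr rfl fun j _ => ?_
    simp only [CVF.act, mul_add, Finset.mul_sum, wzb_wz_cx hρ]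
    congr 1
    · exact Finset.sum_congr rfl fun k _ => by simp only [CVF.coef, Sum.elim_inl]; ring
    · exact Finset.sum_congr rfl fun k _ => by simp only [CVF.coef, Sum.elim_inl]; ring
  rw [hpair hW, hpair hV]
  have hcomm : ∑ j, ∑ k, W.hol j x * V.hol k x * wz k (wz j (cx ρ)) x =
      ∑ j, ∑ k, V.hol j x * W.hol k x * wz k (wz j (cx ρ)) x := by
    rw [Finset.sum_comm]
    refine Finset.sum_congr rfl fun j _ => Finset.sum_congr rfl fun k _ => ?_
    rw [show wz j (wz k (cx ρ)) x = wz k (wz j (cx ρ)) x from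
      wirt_comm (contDiff_cx hρ) (Sum.inl j) (Sum.inl k) x]
    ring
  rw [hcomm]
  simp only [pairDRho, CVF.bracket, sub_mul, Finset.sum_sub_distrib]
  ring

end Levi

section CRFields

variable {n : ℕ} {f : Cn n → ℂ} {ρ : Cn n → ℝ} {x p : Cn n} {a ξ η c : Fin n → Cn n → ℂ}

theorem LVF_act (a : Fin n → Cn n → ℂ) (f : Cn n → ℂ) (x : Cn n) :
    (LVF a).act f x = ∑ j, a j x * wz j f x := by
  simp [CVF.act, LVF]

theorem LbarVF_act (a : Fin n → Cn n → ℂ) (f : Cn n → ℂ) (x : Cn n) :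
    (LbarVF a).act f x = ∑ j, starRingEnd ℂ (a j x) * wzb j f x := by
  simp [CVF.act, LbarVF]

theorem LbarVF_isSmooth (ha : ∀ j, ContDiff ℝ (⊤ : ℕ∞) (a j)) : (LbarVF a).IsSmooth := by
  rintro (j | j)
  · exact contDiff_const
  · exact contDiff_star (ha j)

theorem star_LVF_act (hf : ContDiff ℝ (⊤ : ℕ∞) f) (x : Cn n) :
    starRingEnd ℂ ((LVF a).act f x) = (LbarVF a).act (fun x => starRingEnd ℂ (f x)) x := by
  simp only [LVF_act, LbarVF_act, map_sum, map_mul, wzb_star hf]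

theorem star_LbarVF_act (hf : ContDiff ℝ (⊤ : ℕ∞) f) (x : Cn n) :
    starRingEnd ℂ ((LbarVF a).act f x) = (LVF a).act (fun x => starRingEnd ℂ (f x)) x := by
  simp only [LVF_act, LbarVF_act, map_sum, map_mul, wz_star hf, Complex.conj_conj]

theorem LbarVF_act_levi (hρ : ContDiff ℝ (⊤ : ℕ∞) ρ) (hξ : ∀ j, ContDiff ℝ (⊤ : ℕ∞) (ξ j))
    (hη : ∀ j, ContDiff ℝ (⊤ : ℕ∞) (η j)) (c : Fin n → Cn n → ℂ) (x : Cn n) :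
    (LbarVF c).act (levi ρ ξ η) x =
      ∑ j, ∑ k, ∑ l, wzb l (leviCoeff ρ j k) x * ξ j x *
        starRingEnd ℂ (η k x) * starRingEnd ℂ (c l x) +
      levi ρ (fun j => (LbarVF c).act (ξ j)) η x + levi ρ ξ (fun k => (LVF c).act (η k)) x := by
  have hR := fun i : Fin n × Fin n => (contDiff_leviCoeff hρ i.1 i.2).mul (hξ i.1)
  have e : levi ρ ξ η = fun x => ∑ i : Fin n × Fin n,
      leviCoeff ρ i.1 i.2 x * ξ i.1 x * starRingEnd ℂ (η i.2 x) :=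
    funext fun x => by rw [levi, Fintype.sum_prod_type]
  have hmul : ∀ i : Fin n × Fin n, (LbarVF c).act (fun x => leviCoeff ρ i.1 i.2 x * ξ i.1 x) x =
      (LbarVF c).act (leviCoeff ρ i.1 i.2) x * ξ i.1 x +
        leviCoeff ρ i.1 i.2 x * (LbarVF c).act (ξ i.1) x := by
    intro i
    simpa using (LbarVF c).act_sum_mul (α := Unit) (fun _ => contDiff_leviCoeff hρ i.1 i.2)
      (fun _ => hξ i.1) x
  rw [e, (LbarVF c).act_sum_mul hR fun i => contDiff_star (hη i.2)]
  simp only [hmul, ← star_LVF_act (hη _), Fintype.sum_prod_type, levi]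
  simp only [← Finset.sum_add_distrib]
  refine Finset.sum_congr rfl fun j _ => Finset.sum_congr rfl fun k _ => ?_
  rw [LbarVF_act (f := leviCoeff ρ j k), Finset.sum_mul, add_mul, Finset.sum_mul]
  congr 2
  exact Finset.sum_congr rfl fun l _ => by ring

/-- The pairing of `∂ρ` with the `(1,0)` field with coefficients `ξ`. -/
noncomputable def normalPart (ρ : Cn n → ℝ) (ξ : Fin n → Cn n → ℂ) (x : Cn n) : ℂ :=
  ∑ j, ξ j x * wz j (cx ρ) x

theorem normalPart_LbarVF_act (hρ : ContDiff ℝ (⊤ : ℕ∞) ρ) (hξ : ∀ j, ContDiff ℝ (⊤ : ℕ∞) (ξ j))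
    (c : Fin n → Cn n → ℂ) (x : Cn n) :
    normalPart ρ (fun j => (LbarVF c).act (ξ j)) x =
      (LbarVF c).act (normalPart ρ ξ) x - levi ρ ξ c x := by
  change ∑ j, _ = (LbarVF c).act (fun x => ∑ j, ξ j x * wz j (cx ρ) x) x - _
  rw [(LbarVF c).act_sum_mul hξ fun j => contDiff_wz (contDiff_cx hρ) j, levi,
    ← Finset.sum_sub_distrib]
  refine Finset.sum_congr rfl fun j _ => ?_
  rw [LbarVF_act (f := wz j (cx ρ)), Finset.mul_sum, add_sub_assoc, ← Finset.sum_sub_distrib]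
  simp only [wzb_wz_cx hρ]
  rw [Finset.sum_eq_zero, add_zero]
  intro k _
  ring

theorem normalPart_LVF_act (hρ : ContDiff ℝ (⊤ : ℕ∞) ρ) (hξ : ∀ j, ContDiff ℝ (⊤ : ℕ∞) (ξ j))
    (c : Fin n → Cn n → ℂ) (x : Cn n) :
    normalPart ρ (fun j => (LVF c).act (ξ j)) x =
      (LVF c).act (normalPart ρ ξ) x -
        ∑ j, ∑ k, ξ j x * c k x * wz k (wz j (cx ρ)) x := by
  change ∑ j, _ = (LVF c).act (fun x => ∑ j, ξ j x * wz j (cx ρ) x) x - _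
  rw [(LVF c).act_sum_mul hξ fun j => contDiff_wz (contDiff_cx hρ) j, ← Finset.sum_sub_distrib]
  refine Finset.sum_congr rfl fun j _ => ?_
  rw [LVF_act (f := wz j (cx ρ)), Finset.mul_sum, add_sub_assoc, ← Finset.sum_sub_distrib]
  rw [Finset.sum_eq_zero, add_zero]
  intro k _
  ring

/-- The zero set of `ρ` is a smooth pseudoconvex hypersurface with defining function `ρ`. -/
structure IsPscDefining (ρ : Cn n → ℝ) : Prop where
  smooth : ContDiff ℝ (⊤ : ℕ∞) ρ
  regular : ∀ x, ρ x = 0 → fderiv ℝ ρ x ≠ 0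
  psc : Pseudoconvex ρ {x | ρ x = 0}

/-- The real and imaginary parts `L + L̄` and `i (L - L̄)` as real vector fields on `ℂⁿ`. -/
noncomputable def realFields (a : Fin n → Cn n → ℂ) (b : Bool) (x : Cn n) : Cn n :=
  fun j => (if b then Complex.I else 1) * a j x

/-- The real vector fields `L + L̄` and `i (L - L̄)` as mixed-type fields. -/
noncomputable def realCVF (a : Fin n → Cn n → ℂ) (b : Bool) : CVF n where
  hol := fun j x => (if b then Complex.I else 1) * a j x
  anti := fun j x => starRingEnd ℂ (if b then Complex.I else 1) * starRingEnd ℂ (a j x)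

theorem dirDeriv_realFields (a : Fin n → Cn n → ℂ) (b : Bool) (f : Cn n → ℂ) :
    dirDeriv (realFields a b) f = (realCVF a b).act f := by
  ext x
  rw [dirDeriv, fderiv_apply_eq_sum]
  simp only [realFields, realCVF, CVF.act, map_mul]

theorem inM1_realCVF (a : Fin n → Cn n → ℂ) (b : Bool) : InM1 a (realCVF a b) :=
  ⟨_, _, contDiff_const, contDiff_const, fun _ _ => rfl, fun _ _ => rfl⟩

theorem contDiff_realFields (ha : ∀ j, ContDiff ℝ (⊤ : ℕ∞) (a j)) (b : Bool) :
    ContDiff ℝ (⊤ : ℕ∞) (realFields a b) :=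
  contDiff_pi.2 fun j => contDiff_const.mul (ha j)

theorem InM1.isSmooth (ha : ∀ j, ContDiff ℝ (⊤ : ℕ∞) (a j)) {W : CVF n} (hW : InM1 a W) :
    W.IsSmooth := by
  obtain ⟨c₁, c₂, hc₁, hc₂, h₁, h₂⟩ := hW
  rintro (j | j)
  · rw [show W.coef (Sum.inl j) = fun x => c₁ x * a j x from funext (h₁ j)]
    exact hc₁.mul (ha j)
  · rw [show W.coef (Sum.inr j) = fun x => c₂ x * starRingEnd ℂ (a j x) from funext (h₂ j)]
    exact hc₂.mul (contDiff_star (ha j))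

theorem InM1.act_eq {W : CVF n} {c₁ c₂ : Cn n → ℂ} (h₁ : ∀ j x, W.hol j x = c₁ x * a j x)
    (h₂ : ∀ j x, W.anti j x = c₂ x * starRingEnd ℂ (a j x)) (f : Cn n → ℂ) (x : Cn n) :
    W.act f x = c₁ x * (LVF a).act f x + c₂ x * (LbarVF a).act f x := by
  rw [LVF_act, LbarVF_act]
  simp only [CVF.act, h₁, h₂, Finset.mul_sum, mul_assoc]

theorem star_sum_mul_wz_eq_zero (hρ : ContDiff ℝ (⊤ : ℕ∞) ρ)
    (h : ∑ j, ξ j x * wz j (cx ρ) x = 0) :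
    ∑ j, starRingEnd ℂ (ξ j x) * wzb j (cx ρ) x = 0 := by
  simpa [map_sum, star_wz_cx hρ] using congrArg (starRingEnd ℂ) h

theorem LVF_act_cx (h : ∑ j, ξ j x * wz j (cx ρ) x = 0) : (LVF ξ).act (cx ρ) x = 0 := by
  rw [LVF_act, h]

theorem LbarVF_act_cx (hρ : ContDiff ℝ (⊤ : ℕ∞) ρ) (h : ∑ j, ξ j x * wz j (cx ρ) x = 0) :
    (LbarVF ξ).act (cx ρ) x = 0 := by
  rw [LbarVF_act, star_sum_mul_wz_eq_zero hρ h]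

theorem InM1.act_cx (hρ : ContDiff ℝ (⊤ : ℕ∞) ρ) (ha : IsCRField ρ {x | ρ x = 0} a)
    {W : CVF n} (hW : InM1 a W) (hx : ρ x = 0) : W.act (cx ρ) x = 0 := by
  obtain ⟨c₁, c₂, -, -, h₁, h₂⟩ := hW
  rw [InM1.act_eq h₁ h₂, LVF_act_cx (ha.2 x hx), LbarVF_act_cx hρ (ha.2 x hx)]
  simp

theorem fderiv_realFields (hρ : ContDiff ℝ (⊤ : ℕ∞) ρ) (ha : IsCRField ρ {x | ρ x = 0} a)
    (b : Bool) (x : Cn n) (hx : ρ x = 0) : fderiv ℝ ρ x (realFields a b x) = 0 := by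
  have h := (inM1_realCVF a b).act_cx hρ ha hx
  rw [← dirDeriv_realFields, dirDeriv, fderiv_cx hρ] at h
  exact_mod_cast h

theorem VanishesToOrder.act (ha : ∀ j, ContDiff ℝ (⊤ : ℕ∞) (a j)) {W : CVF n} (hW : InM1 a W)
    (hf : ContDiff ℝ (⊤ : ℕ∞) f) {m : ℕ} (hfm : VanishesToOrder (realFields a) p (m + 1) f) :
    VanishesToOrder (realFields a) p m (W.act f) := by
  obtain ⟨c₁, c₂, hc₁, hc₂, h₁, h₂⟩ := hW
  have hv := contDiff_realFields ha
  have hD := fun b => contDiff_dirDeriv (hv b) hf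
  have e : W.act f = fun x =>
      ((c₁ x + c₂ x) / 2) * dirDeriv (realFields a false) f x +
        (Complex.I * (c₂ x - c₁ x) / 2) * dirDeriv (realFields a true) f x := by
    ext x
    have e₁ : ∀ b, (realCVF a b).act f x = (if b then Complex.I else 1) * (LVF a).act f x +
        starRingEnd ℂ (if b then Complex.I else 1) * (LbarVF a).act f x := fun b =>
      InM1.act_eq (W := realCVF a b) (c₁ := fun _ => if b then Complex.I else 1)
        (c₂ := fun _ => starRingEnd ℂ (if b then Complex.I else 1))
        (fun _ _ => rfl) (fun _ _ => rfl) f x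
    rw [InM1.act_eq h₁ h₂, dirDeriv_realFields, dirDeriv_realFields, e₁, e₁]
    simp
    linear_combination (c₂ x - c₁ x) / 2 * ((LbarVF a).act f x - (LVF a).act f x) * Complex.I_sq
  rw [e]
  have hs := (hc₁.add hc₂).div_const 2
  have hd := (contDiff_const (c := Complex.I).mul (hc₂.sub hc₁)).div_const 2
  exact ((hfm.2 false).mul_left (hD _) hs hv).add (hs.mul (hD _)) (hd.mul (hD _)) hv
    ((hfm.2 true).mul_left (hD _) hd hv)

theorem vanishesToOrder_of_le_nuL {m : ℕ} (h : (m : ℕ∞) ≤ nuL a f p) :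
    VanishesToOrder (realFields a) p m f := by
  refine VanishesToOrder.of_foldl fun w hw => ?_
  by_contra hne
  have e : (w.map (realCVF a)).foldl (fun g W => W.act g) f =
      w.foldl (fun g b => dirDeriv (realFields a b) g) f := by
    simp only [List.foldl_map, dirDeriv_realFields]
  have hle : nuL a f p ≤ (w.length : ℕ∞) := by
    refine sInf_le ⟨w.map (realCVF a), by simp, fun W hW => ?_, by rwa [e]⟩
    obtain ⟨b, -, rfl⟩ := List.mem_map.1 hW
    exact inM1_realCVF a b
  exact absurd (h.trans hle) (by simpa using hw)

end CRFields

section CRProjection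

variable {n : ℕ} {ρ : Cn n → ℝ} {x p : Cn n} {a ξ : Fin n → Cn n → ℂ}

/-- The squared length `∑ |∂ρ/∂z_j|²` of `∂ρ`. -/
noncomputable def gradNormSq (ρ : Cn n → ℝ) (x : Cn n) : ℂ :=
  ∑ j, wzb j (cx ρ) x * wz j (cx ρ) x

/-- The multiple by `∑ |∂ρ/∂z_j|²` of the projection of `ξ` to the CR directions. -/
noncomputable def crPart (ρ : Cn n → ℝ) (ξ : Fin n → Cn n → ℂ) (j : Fin n) (x : Cn n) : ℂ :=
  gradNormSq ρ x * ξ j x + (-normalPart ρ ξ x) * wzb j (cx ρ) x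

theorem contDiff_normalPart (hρ : ContDiff ℝ (⊤ : ℕ∞) ρ) (hξ : ∀ j, ContDiff ℝ (⊤ : ℕ∞) (ξ j)) :
    ContDiff ℝ (⊤ : ℕ∞) (normalPart ρ ξ) :=
  ContDiff.sum fun j _ => (hξ j).mul (contDiff_wz (contDiff_cx hρ) j)

theorem contDiff_gradNormSq (hρ : ContDiff ℝ (⊤ : ℕ∞) ρ) :
    ContDiff ℝ (⊤ : ℕ∞) (gradNormSq ρ) :=
  contDiff_normalPart hρ fun j => contDiff_wzb (contDiff_cx hρ) j

theorem contDiff_crPart (hρ : ContDiff ℝ (⊤ : ℕ∞) ρ) (hξ : ∀ j, ContDiff ℝ (⊤ : ℕ∞) (ξ j))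
    (j : Fin n) : ContDiff ℝ (⊤ : ℕ∞) (crPart ρ ξ j) :=
  ((contDiff_gradNormSq hρ).mul (hξ j)).add
    ((contDiff_normalPart hρ hξ).neg.mul (contDiff_wzb (contDiff_cx hρ) j))

theorem gradNormSq_ne_zero (hρ : ContDiff ℝ (⊤ : ℕ∞) ρ) (hx : fderiv ℝ ρ x ≠ 0) :
    gradNormSq ρ x ≠ 0 := by
  intro h
  have h₁ : gradNormSq ρ x = ((∑ j, Complex.normSq (wz j (cx ρ) x) : ℝ) : ℂ) := by
    simp only [gradNormSq, Complex.ofReal_sum, ← Complex.mul_conj, star_wz_cx hρ, mul_comm]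
  rw [h₁, Complex.ofReal_eq_zero,
    Finset.sum_eq_zero_iff_of_nonneg fun j _ => Complex.normSq_nonneg _] at h
  have h₂ : ∀ j, wz j (cx ρ) x = 0 := fun j => Complex.normSq_eq_zero.1 (h j (Finset.mem_univ j))
  have h₃ : ∀ j, wzb j (cx ρ) x = 0 := fun j => by rw [← star_wz_cx hρ, h₂, map_zero]
  refine hx (ContinuousLinearMap.ext fun w => ?_)
  have h₄ := fderiv_apply_eq_sum (cx ρ) x w
  rw [fderiv_cx hρ] at h₄
  simpa [h₂, h₃] using h₄

theorem normalPart_crPart (ρ : Cn n → ℝ) (ξ : Fin n → Cn n → ℂ) (x : Cn n) :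
    normalPart ρ (crPart ρ ξ) x = 0 := by
  have : normalPart ρ (crPart ρ ξ) x =
      gradNormSq ρ x * normalPart ρ ξ x + (-normalPart ρ ξ x) * gradNormSq ρ x := by
    rw [normalPart]
    simp only [crPart, add_mul, Finset.sum_add_distrib, mul_assoc, ← Finset.mul_sum]
    rfl
  rw [this]
  ring

/-- If `λ(ξ', ξ')`, for the CR part `ξ'` of `ξ`, and `λ(a, a)` vanish to orders `l` and `m`,
then `λ(ξ, a)` vanishes to half the total order, provided that `∂ρ(ξ)` does. -/
theorem IsPscDefining.vanishesToOrder_levi (hS : IsPscDefining ρ)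
    (ha : IsCRField ρ {x | ρ x = 0} a) (hp : ρ p = 0) (hξ : ∀ j, ContDiff ℝ (⊤ : ℕ∞) (ξ j))
    {k l m : ℕ} (hm : VanishesToOrder (realFields a) p m (levi ρ a a))
    (hl : VanishesToOrder (realFields a) p l (levi ρ (crPart ρ ξ) (crPart ρ ξ)))
    (hk : VanishesToOrder (realFields a) p k (normalPart ρ ξ)) (hklm : 2 * k < m + l + 2) :
    VanishesToOrder (realFields a) p k (levi ρ ξ a) := by
  have hρ := hS.smooth
  have hX := contDiff_crPart hρ hξ
  have hν := contDiff_wzb (contDiff_cx hρ)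
  have hN := contDiff_gradNormSq hρ
  have hq := contDiff_normalPart hρ hξ
  have hv := contDiff_realFields ha.1
  have h₁ : VanishesToOrder (realFields a) p k (levi ρ (crPart ρ ξ) a) := by
    refine VanishesToOrder.of_sq_le hv hρ hp (hS.regular p hp) (fderiv_realFields hρ ha)
      (contDiff_levi hρ hX ha.1) (contDiff_levi hρ ha.1 ha.1) (contDiff_levi hρ hX hX)
      (fun x hx => ?_) hm hl hklm
    have h := hS.psc.sq_norm_levi_le hρ (x := x) hx (normalPart_crPart ρ ξ x) (ha.2 x hx)
    have h0 : ∀ z w : ℂ, z.re * w.re ≤ ‖w‖ * ‖z‖ := fun z w => by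
      rw [mul_comm ‖w‖]
      calc z.re * w.re ≤ |z.re * w.re| := le_abs_self _
        _ = |z.re| * |w.re| := abs_mul _ _
        _ ≤ ‖z‖ * ‖w‖ := by gcongr <;> exact Complex.abs_re_le_norm _
    exact h.trans (h0 _ _)
  have h₂ : (fun x => gradNormSq ρ x * levi ρ ξ a x) = fun x =>
      levi ρ (crPart ρ ξ) a x + levi ρ (fun j => wzb j (cx ρ)) a x * normalPart ρ ξ x := by
    ext x
    have := levi_comb_left ρ ξ (fun j => wzb j (cx ρ)) a (gradNormSq ρ)
      (fun x => -normalPart ρ ξ x) x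
    rw [show levi ρ (crPart ρ ξ) a x = _ from this]
    ring
  have hνa := contDiff_levi hρ hν ha.1
  refine VanishesToOrder.of_mul_left (contDiff_levi hρ hξ ha.1) hN hv
    (gradNormSq_ne_zero hρ (hS.regular p hp)) ?_
  rw [h₂]
  exact h₁.add (contDiff_levi hρ hX ha.1) (hνa.mul hq) hv (hk.mul_left hq hνa hv)

end CRProjection

section DbarSelf

variable {n : ℕ} {ρ : Cn n → ℝ} {f g : Cn n → ℂ} {x p : Cn n} {a ξ η : Fin n → Cn n → ℂ}

theorem CVF.act_add (V : CVF n) (hf : ContDiff ℝ (⊤ : ℕ∞) f) (hg : ContDiff ℝ (⊤ : ℕ∞) g)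
    (x : Cn n) : V.act (fun x => f x + g x) x = V.act f x + V.act g x := by
  simp only [CVF.act, wz, wzb, fderiv_fun_add (hf.differentiable (by simp)).differentiableAt
    (hg.differentiable (by simp)).differentiableAt, add_apply]
  simp only [← Finset.sum_add_distrib]
  exact Finset.sum_congr rfl fun j _ => by ring

theorem CVF.act_eq_zero_of_eqOn (hρ : ContDiff ℝ (⊤ : ℕ∞) ρ) (hx : ρ x = 0)
    (hdx : fderiv ℝ ρ x ≠ 0) (hf : ContDiff ℝ (⊤ : ℕ∞) f) (h : ∀ y, ρ y = 0 → f y = 0)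
    {W : CVF n} (hW : W.act (cx ρ) x = 0) : W.act f x = 0 :=
  act_eq_zero_of_nonneg hρ hx hdx hf (fun y hy => by simp [h y hy]) (fun y hy => by simp [h y hy])
    (h x hx) hW

/-- The `(1,0)` coefficients of `[L̄, L]`. -/
noncomputable def dbarSelf (a : Fin n → Cn n → ℂ) (j : Fin n) : Cn n → ℂ := (LbarVF a).act (a j)

theorem contDiff_dbarSelf (ha : ∀ j, ContDiff ℝ (⊤ : ℕ∞) (a j)) (j : Fin n) :
    ContDiff ℝ (⊤ : ℕ∞) (dbarSelf a j) :=
  CVF.contDiff_act (LbarVF_isSmooth ha) (ha j)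

theorem inM1_LVF (a : Fin n → Cn n → ℂ) : InM1 a (LVF a) :=
  ⟨fun _ => 1, fun _ => 0, contDiff_const, contDiff_const, by simp [LVF], by simp [LVF]⟩

theorem inM1_LbarVF (a : Fin n → Cn n → ℂ) : InM1 a (LbarVF a) :=
  ⟨fun _ => 0, fun _ => 1, contDiff_const, contDiff_const, by simp [LbarVF], by simp [LbarVF]⟩

namespace IsPscDefining

theorem levi_eq_zero_left (hS : IsPscDefining ρ) (hx : ρ x = 0) (hξ : normalPart ρ ξ x = 0)
    (hη : normalPart ρ η x = 0) (h : levi ρ ξ ξ x = 0) : levi ρ ξ η x = 0 := by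
  have := hS.psc.sq_norm_levi_le hS.smooth (x := x) hx hξ hη
  rw [h, Complex.zero_re, zero_mul] at this
  exact norm_eq_zero.1 (pow_eq_zero_iff two_ne_zero |>.1 (this.antisymm (sq_nonneg _)))

theorem levi_eq_zero_right (hS : IsPscDefining ρ) (hx : ρ x = 0) (hξ : normalPart ρ ξ x = 0)
    (hη : normalPart ρ η x = 0) (h : levi ρ η η x = 0) : levi ρ ξ η x = 0 := by
  rw [← star_levi hS.smooth, hS.levi_eq_zero_left hx hη hξ h, map_zero]

theorem normalPart_dbarSelf (hS : IsPscDefining ρ) (ha : IsCRField ρ {x | ρ x = 0} a)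
    (hx : ρ x = 0) : normalPart ρ (dbarSelf a) x = -levi ρ a a x := by
  have h := normalPart_LbarVF_act hS.smooth ha.1 a x
  rw [CVF.act_eq_zero_of_eqOn hS.smooth hx (hS.regular x hx) (contDiff_normalPart hS.smooth ha.1)
    ha.2 (LbarVF_act_cx hS.smooth (ha.2 x hx)), zero_sub] at h
  exact h

/-- For `b = [L̄, L]`, comparing `L̄ λ(a, b)` with `b̄ λ(a, a)`, the vanishing at `p` of `λ(a, a)`,
`λ(b, a)` and their first derivatives forces `λ(b, b)` to vanish. -/
theorem levi_dbarSelf_eq_zero (hS : IsPscDefining ρ) (ha : IsCRField ρ {x | ρ x = 0} a)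
    (hp : ρ p = 0) (h₀ : levi ρ a a p = 0) (h₁ : (LVF a).act (levi ρ a a) p = 0)
    (h₂ : levi ρ a (dbarSelf a) p = 0)
    (h₃ : (LbarVF a).act (levi ρ a (dbarSelf a)) p = 0) :
    levi ρ (dbarSelf a) (dbarSelf a) p = 0 := by
  have hρ := hS.smooth
  have hb := contDiff_dbarSelf ha.1
  set b := dbarSelf a with hbdef
  have hdp := hS.regular p hp
  have hq : normalPart ρ b p = 0 := by rw [hS.normalPart_dbarSelf ha hp, h₀, neg_zero]
  have hqa := contDiff_normalPart hρ ha.1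
  have hqb := contDiff_normalPart hρ hb
  have hlam := contDiff_levi hρ ha.1 ha.1
  have e₁ := LbarVF_act_levi hρ ha.1 hb a p
  have e₂ := LbarVF_act_levi hρ ha.1 ha.1 b p
  have hB : (LbarVF b).act (levi ρ a a) p = 0 :=
    CVF.act_eq_zero_of_nonneg hρ hp hdp hlam (fun y hy => hS.psc y hy _ (ha.2 y hy))
      (fun y _ => levi_self_im hρ a y) h₀ (LbarVF_act_cx hρ hq)
  have hT : ∑ j, ∑ k, ∑ l, wzb l (leviCoeff ρ j k) p * a j p *
        starRingEnd ℂ (b k p) * starRingEnd ℂ (a l p) =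
      ∑ j, ∑ k, ∑ l, wzb l (leviCoeff ρ j k) p * a j p *
        starRingEnd ℂ (a k p) * starRingEnd ℂ (b l p) := by
    refine Finset.sum_congr rfl fun j _ => ?_
    rw [Finset.sum_comm]
    refine Finset.sum_congr rfl fun k _ => Finset.sum_congr rfl fun l _ => ?_
    rw [wzb_leviCoeff_comm hρ]
    ring
  have hBa : normalPart ρ (fun j => (LbarVF b).act (a j)) p = 0 := by
    have h := normalPart_LbarVF_act hρ ha.1 b p
    rw [h₂, CVF.act_eq_zero_of_eqOn hρ hp hdp hqa ha.2 (LbarVF_act_cx hρ hq), sub_zero] at h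
    exact h
  have hLq : (LVF a).act (normalPart ρ b) p = 0 := by
    have h := (LVF a).act_add hqb hlam p
    rwa [CVF.act_eq_zero_of_eqOn hρ hp hdp (hqb.add hlam)
      (fun y hy => by rw [hS.normalPart_dbarSelf ha hy, neg_add_cancel]) (LVF_act_cx (ha.2 p hp)),
      h₁, add_zero, eq_comm] at h
  have hC : normalPart ρ (fun j x => 1 * (LVF a).act (b j) x + (-1) * (LVF b).act (a j) x) p =
      0 := by
    have h := normalPart_LVF_act hρ hb a p
    have h' := normalPart_LVF_act hρ ha.1 b p
    have hs : ∑ j, ∑ k, b j p * a k p * wz k (wz j (cx ρ)) p =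
        ∑ j, ∑ k, a j p * b k p * wz k (wz j (cx ρ)) p := by
      rw [Finset.sum_comm]
      refine Finset.sum_congr rfl fun j _ => Finset.sum_congr rfl fun k _ => ?_
      rw [show wz j (wz k (cx ρ)) p = wz k (wz j (cx ρ)) p from
        wirt_comm (contDiff_cx hρ) (Sum.inl j) (Sum.inl k) p]
      ring
    rw [hLq] at h
    rw [CVF.act_eq_zero_of_eqOn hρ hp hdp hqa ha.2 (LVF_act_cx hq)] at h'
    have e : normalPart ρ (fun j x => 1 * (LVF a).act (b j) x + (-1) * (LVF b).act (a j) x) p =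
        normalPart ρ (fun j => (LVF a).act (b j)) p -
          normalPart ρ (fun j => (LVF b).act (a j)) p := by
      simp only [normalPart, ← Finset.sum_sub_distrib]
      exact Finset.sum_congr rfl fun j _ => by ring
    rw [e, h, h', hs]
    ring
  have z₁ := hS.levi_eq_zero_right hp hBa (ha.2 p hp) h₀
  have z₂ := hS.levi_eq_zero_left hp (ha.2 p hp) hC h₀
  rw [levi_comb_right ρ (fun j => (LVF a).act (b j)) (fun j => (LVF b).act (a j)) a
    (fun _ => 1) (fun _ => -1) p] at z₂
  rw [h₃, show (fun j => (LbarVF a).act (a j)) = b from rfl] at e₁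
  rw [hB, z₁] at e₂
  simp only [map_neg, map_one] at z₂
  linear_combination e₂ - e₁ - hT - z₂

theorem vanishesToOrder_two (hS : IsPscDefining ρ) (ha : IsCRField ρ {x | ρ x = 0} a)
    (hp : ρ p = 0) (hξ : ∀ j, ContDiff ℝ (⊤ : ℕ∞) (ξ j))
    (hCR : ∀ x, ρ x = 0 → normalPart ρ ξ x = 0) (h : levi ρ ξ ξ p = 0) :
    VanishesToOrder (realFields a) p 2 (levi ρ ξ ξ) := by
  refine ⟨h, fun i => ⟨?_, fun _ => trivial⟩⟩
  rw [dirDeriv_realFields]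
  exact CVF.act_eq_zero_of_nonneg hS.smooth hp (hS.regular p hp) (contDiff_levi hS.smooth hξ hξ)
    (fun y hy => hS.psc y hy _ (hCR y hy)) (fun y _ => levi_self_im hS.smooth ξ y) h
    ((inM1_realCVF a i).act_cx hS.smooth ha hp)

theorem vanishesToOrder_levi_dbarSelf (hS : IsPscDefining ρ) (ha : IsCRField ρ {x | ρ x = 0} a)
    (hp : ρ p = 0) {t : ℕ} (h₁ : VanishesToOrder (realFields a) p (t - 1) (levi ρ a a))
    (h₂ : VanishesToOrder (realFields a) p (2 * t - 7) (levi ρ a a)) :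
    VanishesToOrder (realFields a) p (t - 2) (levi ρ (dbarSelf a) a) := by
  have hρ := hS.smooth
  have hb := contDiff_dbarSelf ha.1
  have hv := contDiff_realFields ha.1
  have hlam := contDiff_levi hρ ha.1 ha.1
  have hq : VanishesToOrder (realFields a) p (t - 1) (normalPart ρ (dbarSelf a)) := by
    refine VanishesToOrder.congr_of_eqOn hρ hS.regular hv (fderiv_realFields hρ ha)
      (contDiff_const.mul hlam) (contDiff_normalPart hρ hb) hp (fun x hx => ?_)
      (h₁.mul_left hlam (contDiff_const (c := (-1 : ℂ))) hv)
    rw [hS.normalPart_dbarSelf ha hx]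
    ring
  rcases le_or_gt t 4 with ht | ht
  · exact hS.vanishesToOrder_levi ha hp hb h₁ (l := 0) trivial (hq.mono (by omega)) (by omega)
  have h₃ : VanishesToOrder (realFields a) p 2 (levi ρ (dbarSelf a) a) :=
    hS.vanishesToOrder_levi ha hp hb h₂ (l := 0) trivial (hq.mono (by omega)) (by omega)
  have h₄ : VanishesToOrder (realFields a) p 2 (levi ρ a (dbarSelf a)) := by
    simpa only [star_levi hρ] using h₃.star (contDiff_levi hρ hb ha.1) hv
  have hlam₂ : VanishesToOrder (realFields a) p 2 (levi ρ a a) := h₁.mono (by omega)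
  have h₅ : levi ρ (dbarSelf a) (dbarSelf a) p = 0 :=
    hS.levi_dbarSelf_eq_zero ha hp hlam₂.1
      (VanishesToOrder.act ha.1 (inM1_LVF a) hlam hlam₂).1 h₄.1
      (VanishesToOrder.act ha.1 (inM1_LbarVF a) (contDiff_levi hρ ha.1 hb) h₄).1
  have h₆ : levi ρ (crPart ρ (dbarSelf a)) (crPart ρ (dbarSelf a)) p = 0 := by
    have hqp : normalPart ρ (dbarSelf a) p = 0 := (hq.mono (by omega : 1 ≤ t - 1)).1
    have e : levi ρ (crPart ρ (dbarSelf a)) (crPart ρ (dbarSelf a)) p =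
        gradNormSq ρ p * starRingEnd ℂ (gradNormSq ρ p) *
          levi ρ (dbarSelf a) (dbarSelf a) p := by
      simp only [levi, crPart, hqp, neg_zero, zero_mul, add_zero, map_mul, Finset.mul_sum]
      exact Finset.sum_congr rfl fun j _ => Finset.sum_congr rfl fun l _ => by ring
    rw [e, h₅, mul_zero]
  exact hS.vanishesToOrder_levi ha hp hb h₂
    (hS.vanishesToOrder_two ha hp (contDiff_crPart hρ hb) (fun x _ => normalPart_crPart ρ _ x) h₆)
    (hq.mono (by omega)) (by omega)

end IsPscDefining

end DbarSelf

section Commutators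

variable {n : ℕ} {ρ : Cn n → ℝ} {f g : Cn n → ℂ} {x p : Cn n} {a : Fin n → Cn n → ℂ} {m t μ : ℕ}

theorem VanishesToOrder.zero {E ι : Type*} [NormedAddCommGroup E] [NormedSpace ℝ E]
    (v : ι → E → E) (p : E) (m : ℕ) : VanishesToOrder v p m fun _ => 0 := by
  induction m with
  | zero => trivial
  | succ m ih =>
    refine ⟨rfl, fun i => ?_⟩
    rwa [show dirDeriv (v i) (fun _ => (0 : ℂ)) = fun _ => 0 from by ext; simp [dirDeriv]]

theorem CVF.act_mul (V : CVF n) (hf : ContDiff ℝ (⊤ : ℕ∞) f) (hg : ContDiff ℝ (⊤ : ℕ∞) g)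
    (x : Cn n) : V.act (fun x => f x * g x) x = V.act f x * g x + f x * V.act g x := by
  simpa using V.act_sum_mul (α := Unit) (fun _ => hf) (fun _ => hg) x

/-- The `(1,0)` coefficients of the conjugate of `W`. -/
def CVF.conjAnti (W : CVF n) (k : Fin n) (x : Cn n) : ℂ := starRingEnd ℂ (W.anti k x)

theorem levi_hol (ρ : Cn n → ℝ) {W : CVF n} {c₁ : Cn n → ℂ} (b : Fin n → Cn n → ℂ)
    (h : ∀ j x, W.hol j x = c₁ x * a j x) (x : Cn n) :
    levi ρ W.hol b x = c₁ x * levi ρ a b x := by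
  simp only [levi, h, Finset.mul_sum]
  exact Finset.sum_congr rfl fun j _ => Finset.sum_congr rfl fun l _ => by ring

theorem levi_conjAnti (ρ : Cn n → ℝ) {W : CVF n} {c₂ : Cn n → ℂ} (b : Fin n → Cn n → ℂ)
    (h : ∀ j x, W.anti j x = c₂ x * starRingEnd ℂ (a j x)) (x : Cn n) :
    levi ρ b W.conjAnti x = c₂ x * levi ρ b a x := by
  simp only [levi, CVF.conjAnti, Complex.conj_conj, h, Finset.mul_sum]
  exact Finset.sum_congr rfl fun j _ => Finset.sum_congr rfl fun l _ => by ring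

theorem normalPart_conjAnti (hρ : ContDiff ℝ (⊤ : ℕ∞) ρ) {W : CVF n}
    (h : W.act (cx ρ) x = 0) :
    normalPart ρ W.conjAnti x = -starRingEnd ℂ (pairDRho ρ W x) := by
  have e : normalPart ρ W.conjAnti x = starRingEnd ℂ (∑ j, W.anti j x * wzb j (cx ρ) x) := by
    simp only [normalPart, CVF.conjAnti, map_sum, map_mul, star_wzb_cx hρ]
  rw [e, eq_neg_iff_add_eq_zero, ← map_add, add_comm]
  exact (congrArg _ h).trans (map_zero _)

theorem InM1.pairDRho_eq_zero (ha : IsCRField ρ {x | ρ x = 0} a) {W : CVF n} (hW : InM1 a W)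
    (hx : ρ x = 0) : pairDRho ρ W x = 0 := by
  obtain ⟨c₁, c₂, -, -, h₁, -⟩ := hW
  simp only [pairDRho, h₁, mul_assoc, ← Finset.mul_sum, ha.2 x hx, mul_zero]

theorem InM1.bracket_coeffs (ha : ∀ j, ContDiff ℝ (⊤ : ℕ∞) (a j)) {V W : CVF n}
    (hV : InM1 a V) (hW : InM1 a W) :
    ∃ α β γ δ : Cn n → ℂ, ContDiff ℝ (⊤ : ℕ∞) α ∧ ContDiff ℝ (⊤ : ℕ∞) β ∧
      ContDiff ℝ (⊤ : ℕ∞) γ ∧ ContDiff ℝ (⊤ : ℕ∞) δ ∧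
      (∀ j x, (V.bracket W).hol j x = α x * a j x + β x * dbarSelf a j x) ∧
      (∀ j x, (V.bracket W).anti j x =
        γ x * starRingEnd ℂ (a j x) + δ x * starRingEnd ℂ (dbarSelf a j x)) := by
  have hVs := hV.isSmooth ha
  have hWs := hW.isSmooth ha
  obtain ⟨c, d, hc, hd, hV₁, hV₂⟩ := hV
  obtain ⟨e, f, he, hf, hW₁, hW₂⟩ := hW
  refine ⟨fun x => V.act e x - W.act c x, fun x => e x * d x - c x * f x,
    fun x => V.act f x - W.act d x, fun x => f x * c x - d x * e x,
    (CVF.contDiff_act hVs he).sub (CVF.contDiff_act hWs hc), (he.mul hd).sub (hc.mul hf),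
    (CVF.contDiff_act hVs hf).sub (CVF.contDiff_act hWs hd), (hf.mul hc).sub (hd.mul he),
    fun j x => ?_, fun j x => ?_⟩
  · rw [show (V.bracket W).hol j x = V.act (W.hol j) x - W.act (V.hol j) x from rfl,
      show W.hol j = _ from funext (hW₁ j), show V.hol j = _ from funext (hV₁ j),
      V.act_mul he (ha j), W.act_mul hc (ha j), InM1.act_eq hV₁ hV₂ (a j),
      InM1.act_eq hW₁ hW₂ (a j), dbarSelf]
    ring
  · have hs := contDiff_star (ha j)
    rw [show (V.bracket W).anti j x = V.act (W.anti j) x - W.act (V.anti j) x from rfl,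
      show W.anti j = _ from funext (hW₂ j), show V.anti j = _ from funext (hV₂ j),
      V.act_mul hf hs, W.act_mul hd hs, InM1.act_eq hV₁ hV₂ fun x => starRingEnd ℂ (a j x),
      InM1.act_eq hW₁ hW₂ fun x => starRingEnd ℂ (a j x), dbarSelf, star_LbarVF_act (ha j)]
    ring

/-- The properties that hold for a commutator of length `μ` when the Levi form `λ(a, a)` vanishes
to high order compared to `t`. -/
structure CommutatorVanishing (ρ : Cn n → ℝ) (a : Fin n → Cn n → ℂ) (p : Cn n) (t μ : ℕ)
    (G : CVF n) : Prop where
  one_le : 1 ≤ μ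
  inM1 : μ = 1 → InM1 a G
  smooth : G.IsSmooth
  tangent : ∀ x, ρ x = 0 → G.act (cx ρ) x = 0
  pair : VanishesToOrder (realFields a) p (t + 1 - μ) (pairDRho ρ G)
  hol : VanishesToOrder (realFields a) p (t - μ) (levi ρ G.hol a)
  anti : VanishesToOrder (realFields a) p (t - μ) (levi ρ a G.conjAnti)

namespace IsPscDefining

theorem congr (hS : IsPscDefining ρ) (ha : IsCRField ρ {x | ρ x = 0} a) (hp : ρ p = 0)
    (hf : ContDiff ℝ (⊤ : ℕ∞) f) (hg : ContDiff ℝ (⊤ : ℕ∞) g) (h : ∀ x, ρ x = 0 → f x = g x)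
    (hfm : VanishesToOrder (realFields a) p m f) : VanishesToOrder (realFields a) p m g :=
  hfm.congr_of_eqOn hS.smooth hS.regular (contDiff_realFields ha.1)
    (fderiv_realFields hS.smooth ha) hf hg hp h

theorem commutatorVanishing_one (hS : IsPscDefining ρ) (ha : IsCRField ρ {x | ρ x = 0} a)
    (hp : ρ p = 0) (hlam : VanishesToOrder (realFields a) p (t - 1) (levi ρ a a)) {W : CVF n}
    (hW : InM1 a W) : CommutatorVanishing ρ a p t 1 W := by
  have hW' := hW
  have hWs := hW.isSmooth ha.1
  obtain ⟨c₁, c₂, hc₁, hc₂, h₁, h₂⟩ := hW'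
  have hl := contDiff_levi hS.smooth ha.1 ha.1
  have hv := contDiff_realFields ha.1
  refine ⟨le_rfl, fun _ => hW, hWs, fun x hx => hW.act_cx hS.smooth ha hx,
    hS.congr ha hp contDiff_const (contDiff_normalPart hS.smooth fun j => hWs (Sum.inl j))
      (fun x hx => (hW.pairDRho_eq_zero ha hx).symm) (VanishesToOrder.zero _ _ _), ?_, ?_⟩
  · rw [show levi ρ W.hol a = _ from funext (levi_hol ρ a h₁)]
    exact hlam.mul_left hl hc₁ hv
  · rw [show levi ρ a W.conjAnti = _ from funext (levi_conjAnti ρ a h₂)]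
    exact hlam.mul_left hl hc₂ hv

theorem vanishesToOrder_pairDRho_bracket (hS : IsPscDefining ρ)
    (ha : IsCRField ρ {x | ρ x = 0} a) (hp : ρ p = 0) {V W : CVF n} (hV : InM1 a V)
    (hW : CommutatorVanishing ρ a p t μ W) :
    VanishesToOrder (realFields a) p (t - μ) (pairDRho ρ (V.bracket W)) := by
  have hρ := hS.smooth
  have hv := contDiff_realFields ha.1
  have hVs := hV.isSmooth ha.1
  have hWs := hW.smooth
  have hpW : ContDiff ℝ (⊤ : ℕ∞) (pairDRho ρ W) :=
    contDiff_normalPart hρ fun j => hWs (Sum.inl j)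
  have hpV : ContDiff ℝ (⊤ : ℕ∞) (pairDRho ρ V) :=
    contDiff_normalPart hρ fun j => hVs (Sum.inl j)
  have hact : VanishesToOrder (realFields a) p (t - μ) (V.act (pairDRho ρ W)) := by
    rcases le_or_gt μ t with h | h
    · exact VanishesToOrder.act ha.1 hV hpW (hW.pair.mono (by omega))
    · rw [Nat.sub_eq_zero_of_le h.le]
      trivial
  have hV' := hV
  obtain ⟨c, d, hc, hd, hV₁, hV₂⟩ := hV'
  have hA : ContDiff ℝ (⊤ : ℕ∞) (levi ρ W.hol a) :=
    contDiff_levi hρ (fun j => hWs (Sum.inl j)) ha.1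
  have hB : ContDiff ℝ (⊤ : ℕ∞) (levi ρ a W.conjAnti) :=
    contDiff_levi hρ ha.1 fun j => contDiff_star (hWs (Sum.inr j))
  refine hS.congr ha hp ((CVF.contDiff_act hVs hpW).add ((hc.mul hB).sub (hd.mul hA)))
    (contDiff_normalPart hρ fun j => hVs.bracket hWs (Sum.inl j)) (fun x hx => ?_)
    (hact.add (CVF.contDiff_act hVs hpW) ((hc.mul hB).sub (hd.mul hA)) hv
      ((hW.anti.mul_left hB hc hv).sub (hc.mul hB) (hd.mul hA) hv (hW.hol.mul_left hA hd hv)))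
  have e := pairDRho_bracket hρ hVs hWs x
  rw [CVF.act_eq_zero_of_eqOn hρ hx (hS.regular x hx) hpV
    (fun y hy => hV.pairDRho_eq_zero ha hy) (hW.tangent x hx)] at e
  refine Eq.trans ?_ e.symm
  have e₁ : ∑ j, ∑ k, leviCoeff ρ j k x * V.hol j x * W.anti k x =
      c x * levi ρ a W.conjAnti x := by
    rw [← levi_hol ρ W.conjAnti hV₁]
    simp only [levi, CVF.conjAnti, Complex.conj_conj]
  have e₂ : ∑ j, ∑ k, leviCoeff ρ j k x * W.hol j x * V.anti k x = d x * levi ρ W.hol a x := by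
    rw [← levi_conjAnti ρ W.hol hV₂]
    simp only [levi, CVF.conjAnti, Complex.conj_conj]
  rw [e₁, e₂, sub_zero]

theorem commutatorVanishing_bracket (hS : IsPscDefining ρ) (ha : IsCRField ρ {x | ρ x = 0} a)
    (hp : ρ p = 0) (h₁ : VanishesToOrder (realFields a) p (t - 1) (levi ρ a a))
    (h₂ : VanishesToOrder (realFields a) p (2 * t - 7) (levi ρ a a)) {V W : CVF n}
    (hV : InM1 a V) (hW : CommutatorVanishing ρ a p t μ W) :
    CommutatorVanishing ρ a p t (μ + 1) (V.bracket W) := by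
  have hρ := hS.smooth
  have hv := contDiff_realFields ha.1
  have hVs := hV.isSmooth ha.1
  have hWs := hW.smooth
  have hGs := hVs.bracket hWs
  have hlam := contDiff_levi hρ ha.1 ha.1
  have hpair := hS.vanishesToOrder_pairDRho_bracket ha hp hV hW
  have htan : ∀ x, ρ x = 0 → (V.bracket W).act (cx ρ) x = 0 := fun x hx => by
    rw [CVF.bracket_act hVs hWs (contDiff_cx hρ),
      CVF.act_eq_zero_of_eqOn hρ hx (hS.regular x hx) (CVF.contDiff_act hWs (contDiff_cx hρ))
        hW.tangent (hV.act_cx hρ ha hx),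
      CVF.act_eq_zero_of_eqOn hρ hx (hS.regular x hx) (CVF.contDiff_act hVs (contDiff_cx hρ))
        (fun y hy => hV.act_cx hρ ha hy) (hW.tangent x hx), sub_zero]
  have hone := hW.one_le
  have hholanti : VanishesToOrder (realFields a) p (t - (μ + 1)) (levi ρ (V.bracket W).hol a) ∧
      VanishesToOrder (realFields a) p (t - (μ + 1)) (levi ρ a (V.bracket W).conjAnti) := by
    have hxi : ∀ j, ContDiff ℝ (⊤ : ℕ∞) ((V.bracket W).conjAnti j) := fun j =>
      contDiff_star (hGs (Sum.inr j))
    rcases hone.eq_or_lt with rfl | hμ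
    · have hb := contDiff_dbarSelf ha.1
      have hba := contDiff_levi hρ hb ha.1
      have hab := contDiff_levi hρ ha.1 hb
      obtain ⟨α, β, γ, δ, hα, hβ, hγ, hδ, e₁, e₂⟩ := hV.bracket_coeffs ha.1 (hW.inM1 rfl)
      have hlam₂ := h₁.mono (by omega : t - 2 ≤ t - 1)
      have hVba := hS.vanishesToOrder_levi_dbarSelf ha hp h₁ h₂
      have hVab : VanishesToOrder (realFields a) p (t - 2) (levi ρ a (dbarSelf a)) := by
        simpa only [star_levi hρ] using hVba.star hba hv
      constructor
      · have e : levi ρ (V.bracket W).hol a = fun x =>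
            α x * levi ρ a a x + β x * levi ρ (dbarSelf a) a x := by
          ext x
          rw [← levi_comb_left]
          simp only [levi, e₁]
        rw [e]
        exact (hlam₂.mul_left hlam hα hv).add (hα.mul hlam) (hβ.mul hba) hv
          (hVba.mul_left hba hβ hv)
      · have e : levi ρ a (V.bracket W).conjAnti = fun x =>
            γ x * levi ρ a a x + δ x * levi ρ a (dbarSelf a) x := by
          ext x
          have := levi_comb_right ρ a (dbarSelf a) a (fun x => starRingEnd ℂ (γ x))
            (fun x => starRingEnd ℂ (δ x)) x
          simp only [Complex.conj_conj] at this
          rw [← this]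
          simp only [levi, CVF.conjAnti, e₂, map_add, map_mul, Complex.conj_conj]
        rw [e]
        exact (hlam₂.mul_left hlam hγ hv).add (hγ.mul hlam) (hδ.mul hab) hv
          (hVab.mul_left hab hδ hv)
    · have hq : ContDiff ℝ (⊤ : ℕ∞) (pairDRho ρ (V.bracket W)) :=
        contDiff_normalPart hρ fun j => hGs (Sum.inl j)
      have hpair' := hpair.mono (by omega : t - (μ + 1) ≤ t - μ)
      refine ⟨hS.vanishesToOrder_levi ha hp (fun j => hGs (Sum.inl j)) h₂ (l := 0) trivial
        hpair' (by omega), ?_⟩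
      have hn : VanishesToOrder (realFields a) p (t - (μ + 1))
          (normalPart ρ (V.bracket W).conjAnti) := by
        refine hS.congr ha hp (contDiff_const.mul (contDiff_star hq))
          (contDiff_normalPart hρ hxi) (fun x hx => ?_) ((hpair'.star hq hv).mul_left
            (contDiff_star hq) (contDiff_const (c := (-1 : ℂ))) hv)
        rw [normalPart_conjAnti hρ (htan x hx), neg_one_mul]
      have h := hS.vanishesToOrder_levi ha hp hxi h₂ (l := 0) trivial hn (by omega)
      simpa only [star_levi hρ] using h.star (contDiff_levi hρ hxi ha.1) hv
  refine ⟨by omega, fun h => by omega, hGs, htan, ?_, hholanti.1, hholanti.2⟩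
  rwa [Nat.add_sub_add_right]

theorem pairDRho_eq_zero (hS : IsPscDefining ρ) (ha : IsCRField ρ {x | ρ x = 0} a)
    (hp : ρ p = 0) (h₁ : VanishesToOrder (realFields a) p (t - 1) (levi ρ a a))
    (h₂ : VanishesToOrder (realFields a) p (2 * t - 7) (levi ρ a a)) {G : CVF n}
    (hG : IsCommOf a t G) : pairDRho ρ G p = 0 := by
  have key : ∀ {μ : ℕ} {G : CVF n}, IsCommOf a μ G → CommutatorVanishing ρ a p t μ G := by
    intro μ G hG
    induction hG with
    | one W hW => exact hS.commutatorVanishing_one ha hp h₁ hW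
    | succ V W hV _ ih => exact hS.commutatorVanishing_bracket ha hp h₁ h₂ hV ih
  exact ((key hG).pair.mono (by omega : 1 ≤ t + 1 - t)).1

end IsPscDefining

end Commutators

/-- D'Angelo. For a smooth pseudoconvex real hypersurface `M ⊂ ℂⁿ`,
`p ∈ M`, and a smooth CR vector field `L` along `M` with `L(p) ≠ 0`, one has
`c_L(M,p) ≤ max{t_L(M,p), 2 t_L(M,p) − 6}`. -/
theorem cType_le_max {n : ℕ} (hn : 2 ≤ n) (ρ : Cn n → ℝ) (hρ : ContDiff ℝ (⊤ : ℕ∞) ρ)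
    (M : Set (Cn n)) (hM : M = {x | ρ x = 0}) (hreg : ∀ x ∈ M, fderiv ℝ ρ x ≠ 0)
    (hpsc : Pseudoconvex ρ M)
    (p : Cn n) (hp : p ∈ M)
    (a : Fin n → Cn n → ℂ) (ha : IsCRField ρ M a) (hap : (fun j => a j p) ≠ 0) :
    cType ρ a p ≤ max (tType ρ a p) (2 * tType ρ a p - 6) := by
  subst hM
  have hS : IsPscDefining ρ := ⟨hρ, hreg, hpsc⟩
  by_contra! hlt
  obtain ⟨hlt₁, hlt₂⟩ := max_lt_iff.1 hlt
  rw [cType] at hlt₁ hlt₂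
  have hne : {m : ℕ∞ | ∃ μ : ℕ, (μ : ℕ∞) = m ∧
      ∃ G : CVF n, IsCommOf a μ G ∧ pairDRho ρ G p ≠ 0}.Nonempty := by
    by_contra h
    rw [Set.not_nonempty_iff_eq_empty] at h
    rw [tType, h, sInf_empty] at hlt₁
    exact not_top_lt hlt₁
  obtain ⟨t, ht, G, hG, hGp⟩ := csInf_mem hne
  rw [tType, ← ht] at hlt₁ hlt₂
  have hle : ((t - 1 : ℕ) : ℕ∞) ≤ nuL a (levi ρ a a) p ∧
      ((2 * t - 7 : ℕ) : ℕ∞) ≤ nuL a (levi ρ a a) p := by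
    cases hν : nuL a (levi ρ a a) p with
    | top => exact ⟨le_top, le_top⟩
    | coe ν =>
      rw [hν] at hlt₁ hlt₂
      norm_cast at hlt₁ hlt₂ ⊢
      omega
  exact hGp (hS.pairDRho_eq_zero ha hp (vanishesToOrder_of_le_nuL hle.1)
    (vanishesToOrder_of_le_nuL hle.2) hG)
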